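/- Let 0 < α ≤ 1/2, let f ∈ 𝒜_α with f ≢ 0, and let M > 0. Then there exists a sequence (g_n) of functions analytic on 𝔻 and continuous on the closed disc, and constants C_n > 0, such that: (1) for every n, f·g_n ∈ 𝒜_α and ‖f·g_n − f‖_{𝒜_α} → 0 as n → ∞; (2) |g_n(ξ)| ≤ C_n · d(ξ, E_f)^M for all ξ ∈ 𝕋, where d(ξ, E_f) is the distance from ξ to E_f. -/

import Mathlib

open Complex MeasureTheory Set Metric Filter
open scoped ENNReal Classical

noncomputable section

/-- The open unit disc in `ℂ`. -/
def uDisc : Set ℂ := Metric.ball 0 1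

/-- The unit circle in `ℂ`. -/
def uCircle : Set ℂ := Metric.sphere (0 : ℂ) 1

/-- `f` is analytic on the open unit disc and continuous on the closed unit disc. -/
def IsDiscReg (f : ℂ → ℂ) : Prop :=
  DifferentiableOn ℂ f uDisc ∧ ContinuousOn f (Metric.closedBall 0 1)

/-- The little-o Lipschitz condition of order `α` on the closed unit disc:
`|f z - f w| = o(|z-w|^α)` as `|z - w| → 0`. -/
def LittleLip (α : ℝ) (f : ℂ → ℂ) : Prop :=
  ∀ ε > 0, ∃ δ > 0, ∀ z ∈ Metric.closedBall (0 : ℂ) 1, ∀ w ∈ Metric.closedBall (0 : ℂ) 1,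
    ‖z - w‖ < δ → ‖f z - f w‖ ≤ ε * ‖z - w‖ ^ α

/-- Membership in `lip_α`. -/
def MemLip (α : ℝ) (f : ℂ → ℂ) : Prop := IsDiscReg f ∧ LittleLip α f

/-- The Dirichlet integral `D(f) = ∫_𝔻 |f'|² dA` with respect to the normalized
area measure `dA = (1/π)·(Lebesgue)`. -/
def dirInt (f : ℂ → ℂ) : ℝ := (1 / Real.pi) * ∫ z in uDisc, ‖deriv f z‖ ^ 2

/-- Membership in the Dirichlet space `𝒟`. -/
def MemDir (f : ℂ → ℂ) : Prop :=
  DifferentiableOn ℂ f uDisc ∧ IntegrableOn (fun z => ‖deriv f z‖ ^ 2) uDisc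

/-- Sup norm over the unit disc. -/
def supNorm (f : ℂ → ℂ) : ℝ := sSup ((fun z => ‖f z‖) '' uDisc)

/-- The `lip_α` norm `‖f‖_α = ‖f‖_∞ + sup_{z∈𝔻} (1-|z|)^{1-α}|f'(z)|`. -/
def lipNorm (α : ℝ) (f : ℂ → ℂ) : ℝ :=
  supNorm f + sSup ((fun z => (1 - ‖z‖) ^ (1 - α) * ‖deriv f z‖) '' uDisc)

/-- The `𝒜_α` norm `‖f‖_{𝒜_α} = ‖f‖_α + D(f)^{1/2}`. -/
def ANorm (α : ℝ) (f : ℂ → ℂ) : ℝ := lipNorm α f + Real.sqrt (dirInt f)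

/-- Membership in `𝒜_α = 𝒟 ∩ lip_α`. -/
def MemA (α : ℝ) (f : ℂ → ℂ) : Prop := MemDir f ∧ MemLip α f

/-- A closed ideal of the Banach algebra `𝒜_α`, encoded as a set of functions `ℂ → ℂ`
(two functions agreeing on the closed disc represent the same element of `𝒜_α`). -/
structure IsClosedIdeal (α : ℝ) (J : Set (ℂ → ℂ)) : Prop where
  mem_A : ∀ f ∈ J, MemA α f
  zero_mem : (0 : ℂ → ℂ) ∈ J
  add_mem : ∀ f ∈ J, ∀ g ∈ J, f + g ∈ J
  smul_mem : ∀ (c : ℂ), ∀ f ∈ J, c • f ∈ J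
  mul_mem : ∀ f ∈ J, ∀ g : ℂ → ℂ, MemA α g → f * g ∈ J
  ext_mem : ∀ f ∈ J, ∀ g : ℂ → ℂ, MemA α g →
    (∀ z ∈ Metric.closedBall (0 : ℂ) 1, g z = f z) → g ∈ J
  closed : ∀ (F : ℕ → ℂ → ℂ) (f : ℂ → ℂ), (∀ n, F n ∈ J) → MemA α f →
    Tendsto (fun n => ANorm α (F n - f)) atTop (nhds 0) → f ∈ J

/-- The boundary zero set `E_f = {ξ ∈ 𝕋 : f ξ = 0}`. -/
def bZeros (f : ℂ → ℂ) : Set ℂ := {ξ | ξ ∈ uCircle ∧ f ξ = 0}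

/-- An inner function: bounded analytic on `𝔻` with radial limits of modulus `1`
at almost every point of `𝕋`. -/
def IsInner (U : ℂ → ℂ) : Prop :=
  DifferentiableOn ℂ U uDisc ∧ (∀ z ∈ uDisc, ‖U z‖ ≤ 1) ∧
    ∀ᵐ θ : ℝ, Tendsto (fun r : ℝ => ‖U ((r : ℂ) * Complex.exp ((θ : ℂ) * Complex.I))‖)
      (nhdsWithin 1 (Set.Iio 1)) (nhds 1)

/-- The Schwarz/Herglotz kernel `(e^{iθ}+z)/(e^{iθ}-z)`. -/
def circleKernel (z : ℂ) (θ : ℝ) : ℂ :=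
  (Complex.exp ((θ : ℂ) * Complex.I) + z) / (Complex.exp ((θ : ℂ) * Complex.I) - z)

/-- `f` is an outer function. -/
def IsOuter (f : ℂ → ℂ) : Prop :=
  IsDiscReg f ∧ (∃ z ∈ uDisc, f z ≠ 0) ∧
    ∀ z ∈ uDisc, f z = Complex.exp ((1 / (2 * (Real.pi : ℂ))) *
      ∫ θ in (0:ℝ)..(2 * Real.pi),
        circleKernel z θ * (Real.log ‖f (Complex.exp ((θ : ℂ) * Complex.I))‖ : ℂ))

/-- The outer power `f^ρ`, the outer function with boundary modulus `|f|^ρ`. -/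
def outerPow (f : ℂ → ℂ) (ρ : ℝ) (z : ℂ) : ℂ :=
  Complex.exp (((ρ : ℂ) / (2 * (Real.pi : ℂ))) *
    ∫ θ in (0:ℝ)..(2 * Real.pi),
      circleKernel z θ * (Real.log ‖f (Complex.exp ((θ : ℂ) * Complex.I))‖ : ℂ))

/-- The set of angles in `[0, 2π)` whose corresponding point of the circle lies in `A`. -/
def angSet (A : Set ℂ) : Set ℝ :=
  {θ | θ ∈ Set.Ico (0 : ℝ) (2 * Real.pi) ∧ Complex.exp ((θ : ℂ) * Complex.I) ∈ A}

/-- The outer factor `f_Γ` associated with a boundary set `Γ ⊆ 𝕋`. -/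
def outerPart (f : ℂ → ℂ) (Γ : Set ℂ) (z : ℂ) : ℂ :=
  Complex.exp ((1 / (2 * (Real.pi : ℂ))) *
    ∫ θ in angSet Γ, circleKernel z θ * (Real.log ‖f (Complex.exp ((θ : ℂ) * Complex.I))‖ : ℂ))

/-- `𝕋 \ E_f`, the set of boundary points where `f` does not vanish. -/
def offZeros (f : ℂ → ℂ) : Set ℂ := {ξ | ξ ∈ uCircle ∧ f ξ ≠ 0}

/-- `γ` is a component arc (connected component) of `𝕋 \ E_f`. -/
def IsCompArc (f : ℂ → ℂ) (γ : Set ℂ) : Prop :=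
  ∃ x ∈ offZeros f, γ = connectedComponentIn (offZeros f) x

/-- `Γ` is a union of component arcs of `𝕋 \ E_f`. -/
def IsArcUnion (f : ℂ → ℂ) (Γ : Set ℂ) : Prop :=
  Γ ⊆ offZeros f ∧ ∀ x ∈ Γ, connectedComponentIn (offZeros f) x ⊆ Γ

/-- The sector `Δ_γ = {z ∈ 𝔻 : z/|z| ∈ γ}`. -/
def discSector (γ : Set ℂ) : Set ℂ := {z | z ∈ uDisc ∧ ((‖z‖ : ℂ))⁻¹ * z ∈ γ}

/-- Lower integral of `g` over `S` with respect to the normalized area measure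
`dA = (1/π)·(Lebesgue)`. -/
def nlint (S : Set ℂ) (g : ℂ → ℝ) : ℝ≥0∞ :=
  ENNReal.ofReal (1 / Real.pi) * ∫⁻ z in S, ENNReal.ofReal (g z)

/-- `d(z) = min(|z-a|, |z-b|)`, distance to the endpoints of the arc `γ = (a,b)`. -/
def dd (a b z : ℂ) : ℝ := min ‖z - a‖ ‖z - b‖

/-- `Λ_γ`: equals `Γ` if `γ ⊄ Γ`, and `𝕋 \ Γ` if `γ ⊆ Γ`. -/
def lamSet (Γ γ : Set ℂ) : Set ℂ := if γ ⊆ Γ then uCircle \ Γ else Γ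

/-- The function `a_γ(z) = (1/2π)∫_{Λ_γ} (−log|f(e^{iθ})|)/|e^{iθ}−z|² dθ`. -/
def aFun (f : ℂ → ℂ) (Γ γ : Set ℂ) (z : ℂ) : ℝ :=
  (1 / (2 * Real.pi)) * ∫ θ in angSet (lamSet Γ γ),
    (-(Real.log ‖f (Complex.exp ((θ : ℂ) * Complex.I))‖)) /
      ‖Complex.exp ((θ : ℂ) * Complex.I) - z‖ ^ 2

/-- `Δ_γ¹ = {z ∈ Δ_γ : d(z) < 2(1−|z|)}`. -/
def sector1 (a b : ℂ) (γ : Set ℂ) : Set ℂ :=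
  {z | z ∈ discSector γ ∧ dd a b z < 2 * (1 - ‖z‖)}

/-- `Δ_γ² = {z ∈ Δ_γ : d(z) ≥ 2(1−|z|)}`. -/
def sector2 (a b : ℂ) (γ : Set ℂ) : Set ℂ :=
  {z | z ∈ discSector γ ∧ 2 * (1 - ‖z‖) ≤ dd a b z}

/-- `Δ_γ²¹ = {z ∈ Δ_γ² : a_γ(z) ≤ 8|log d(z)|/d(z)}`. -/
def sector21 (f : ℂ → ℂ) (Γ γ : Set ℂ) (a b : ℂ) : Set ℂ :=
  {z | z ∈ sector2 a b γ ∧ aFun f Γ γ z ≤ 8 * |Real.log (dd a b z)| / dd a b z}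

/-- `Δ_γ²² = {z ∈ Δ_γ² : 8|log d(z)|/d(z) < a_γ(z) < 8|log d(z)|/(1−|z|)}`. -/
def sector22 (f : ℂ → ℂ) (Γ γ : Set ℂ) (a b : ℂ) : Set ℂ :=
  {z | z ∈ sector2 a b γ ∧ 8 * |Real.log (dd a b z)| / dd a b z < aFun f Γ γ z ∧
    aFun f Γ γ z < 8 * |Real.log (dd a b z)| / (1 - ‖z‖)}

/-- `Δ_γ²³ = {z ∈ Δ_γ² : a_γ(z) ≥ 8|log d(z)|/(1−|z|)}`. -/
def sector23 (f : ℂ → ℂ) (Γ γ : Set ℂ) (a b : ℂ) : Set ℂ :=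
  {z | z ∈ sector2 a b γ ∧ 8 * |Real.log (dd a b z)| / (1 - ‖z‖) ≤ aFun f Γ γ z}

/-- `μ_z = 1 − 8|log d(z)|/a_γ(z)`. -/
def muOf (f : ℂ → ℂ) (Γ γ : Set ℂ) (a b : ℂ) (z : ℂ) : ℝ :=
  1 - 8 * |Real.log (dd a b z)| / aFun f Γ γ z

/-- The tail union `Γ_m = ⋃_{p ≥ m} γ_p`. -/
def tailUnion (γ : ℕ → Set ℂ) (m : ℕ) : Set ℂ := ⋃ p ∈ Set.Ici m, γ p

end

namespace BoundaryFlat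

open scoped Real Topology

/-- Normalized arc length on the unit circle, in the angular coordinate. -/
noncomputable def circProb : Measure ℝ :=
  ENNReal.ofReal (2 * π)⁻¹ • volume.restrict (Ioc (-π) π)

instance : IsProbabilityMeasure circProb := ⟨by
  have h : (0:ℝ) < 2 * π := by positivity
  simp only [circProb, Measure.smul_apply, Measure.restrict_apply MeasurableSet.univ, univ_inter,
    Real.volume_Ioc, smul_eq_mul]
  rw [← ENNReal.ofReal_mul (by positivity), show π - -π = 2 * π by ring,
    inv_mul_cancel₀ h.ne', ENNReal.ofReal_one]⟩

theorem periodic_comp_circleMap {X : Type*} (F : ℂ → X) :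
    Function.Periodic (fun θ => F (circleMap 0 1 θ)) (2 * π) := fun θ => by
  simp only [periodic_circleMap 0 1 θ]

theorem circleAverage_eq_integral {E : Type*} [NormedAddCommGroup E] [NormedSpace ℝ E]
    (F : ℂ → E) : Real.circleAverage F 0 1 = ∫ θ, F (circleMap 0 1 θ) ∂circProb := by
  have h := (periodic_comp_circleMap F).intervalIntegral_add_eq 0 (-π)
  rw [Real.circleAverage_def, circProb, integral_smul_measure,
    ENNReal.toReal_ofReal (by positivity), ← intervalIntegral.integral_of_le (by linarith [Real.pi_pos])]
  rw [zero_add, show -π + 2 * π = π by ring] at h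
  rw [h]

theorem circleIntegrable_iff_integrable {E : Type*} [NormedAddCommGroup E]
    (F : ℂ → E) : CircleIntegrable F 0 1 ↔ Integrable (fun θ => F (circleMap 0 1 θ)) circProb := by
  rw [circProb, integrable_smul_measure (by simp; positivity) (by simp), CircleIntegrable]
  have h := (periodic_comp_circleMap F)
  rw [← IntegrableOn, ← intervalIntegrable_iff_integrableOn_Ioc_of_le (by linarith [Real.pi_pos])]
  constructor
  · intro h1
    exact h.intervalIntegrable (t := 0) (by positivity) (by simpa using h1) _ _
  · intro h1
    exact h.intervalIntegrable (t := -π) (by positivity)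
      (by rwa [show -π + 2 * π = π by ring]) _ _

theorem lintegral_circProb_rotate (G : ℂ → ℝ≥0∞) (φ : ℝ) :
    ∫⁻ θ, G (circleMap 0 1 θ * circleMap 0 1 φ) ∂circProb =
      ∫⁻ θ, G (circleMap 0 1 θ) ∂circProb := by
  have : Fact (0 < 2 * π) := ⟨by positivity⟩
  have h := periodic_comp_circleMap G
  simp only [circProb, lintegral_smul_measure]
  congr 1
  have e1 := AddCircle.lintegral_preimage (2 * π) (-π) h.lift
  have e2 := AddCircle.lintegral_preimage (2 * π) (-π) (fun x => h.lift (x + (φ : AddCircle (2 * π))))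
  rw [show -π + 2 * π = π by ring] at e1 e2
  rw [lintegral_add_right_eq_self] at e2
  have e3 := e2.trans e1.symm
  simp only [Function.Periodic.lift_coe, ← AddCircle.coe_add] at e3
  rw [← e3]
  simp [circleMap, ← Complex.exp_add, add_mul]

theorem norm_circleMap_one (θ : ℝ) : ‖circleMap 0 1 θ‖ = 1 := by simp

theorem circleMap_mem_closedBall (θ : ℝ) : circleMap 0 1 θ ∈ closedBall (0:ℂ) 1 := by simp

theorem one_sub_norm_le (z : ℂ) (θ : ℝ) : 1 - ‖z‖ ≤ ‖circleMap 0 1 θ - z‖ := by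
  have := norm_sub_norm_le (circleMap 0 1 θ) z
  rwa [norm_circleMap_one] at this

/-- The Poisson kernel of the unit disc in the angular coordinate. -/
noncomputable def pk (z : ℂ) (θ : ℝ) : ℝ := (1 - ‖z‖ ^ 2) / ‖circleMap 0 1 θ - z‖ ^ 2

theorem circleMap_sub_pos {z : ℂ} (hz : ‖z‖ < 1) (θ : ℝ) : 0 < ‖circleMap 0 1 θ - z‖ :=
  lt_of_lt_of_le (by linarith) (one_sub_norm_le z θ)

theorem one_sub_sq_pos {z : ℂ} (hz : ‖z‖ < 1) : 0 < 1 - ‖z‖ ^ 2 := by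
  nlinarith [norm_nonneg z]

theorem pk_nonneg {z : ℂ} (hz : ‖z‖ < 1) (θ : ℝ) : 0 ≤ pk z θ :=
  div_nonneg (one_sub_sq_pos hz).le (by positivity)

theorem continuous_pk {z : ℂ} (hz : ‖z‖ < 1) : Continuous (pk z) := by
  unfold pk
  have : ∀ θ : ℝ, ‖circleMap 0 1 θ - z‖ ^ 2 ≠ 0 := fun θ =>
    (pow_pos (circleMap_sub_pos hz θ) 2).ne'
  fun_prop (disch := assumption)

theorem pk_le {z : ℂ} (hz : ‖z‖ < 1) (θ : ℝ) : pk z θ ≤ 2 / (1 - ‖z‖) := by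
  have h1 := one_sub_norm_le z θ
  have h2 : 0 < 1 - ‖z‖ := by linarith
  unfold pk
  calc (1 - ‖z‖ ^ 2) / ‖circleMap 0 1 θ - z‖ ^ 2 ≤ (1 - ‖z‖ ^ 2) / (1 - ‖z‖) ^ 2 := by
        have := (one_sub_sq_pos hz).le
        gcongr
    _ = (1 + ‖z‖) / (1 - ‖z‖) := by field_simp; ring
    _ ≤ _ := by gcongr; linarith

theorem integrable_pk_mul {z : ℂ} (hz : ‖z‖ < 1) {u : ℝ → ℝ} (hu : Integrable u circProb) :
    Integrable (fun θ => pk z θ * u θ) circProb :=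
  hu.bdd_mul (c := 2 / (1 - ‖z‖)) (continuous_pk hz).aestronglyMeasurable
    (ae_of_all _ fun θ => by rw [Real.norm_of_nonneg (pk_nonneg hz θ)]; exact pk_le hz θ)

theorem integrable_circProb_of_continuous {E : Type*} [NormedAddCommGroup E] {u : ℝ → E}
    (hu : Continuous u) : Integrable u circProb := by
  rw [circProb]
  exact ((hu.integrableOn_Icc (a := -π) (b := π)).mono_set Ioc_subset_Icc_self).smul_measure
    (by simp)

theorem integral_pk_smul {F : ℂ → ℂ} (hF : DiffContOnCl ℂ F (ball 0 1)) {z : ℂ} (hz : ‖z‖ < 1) :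
    ∫ θ, (pk z θ : ℂ) * F (circleMap 0 1 θ) ∂circProb = F z := by
  have h := hF.circleAverage_poissonKernel_smul (w := z) (by simpa using hz)
  rw [circleAverage_eq_integral] at h
  rw [← h]
  simp [poissonKernel_def, pk]

theorem integral_pk {z : ℂ} (hz : ‖z‖ < 1) : ∫ θ, pk z θ ∂circProb = 1 := by
  have h := integral_pk_smul (F := fun _ => 1) diffContOnCl_const hz
  simp only [mul_one, integral_complex_ofReal] at h
  exact_mod_cast h

theorem integral_pk_mul_re {F : ℂ → ℂ} (hF : DiffContOnCl ℂ F (ball 0 1))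
    (hc : Continuous fun θ => F (circleMap 0 1 θ)) {z : ℂ} (hz : ‖z‖ < 1) :
    ∫ θ, pk z θ * (F (circleMap 0 1 θ)).re ∂circProb = (F z).re := by
  rw [← integral_pk_smul hF hz]
  have := integral_re (𝕜 := ℂ) (integrable_circProb_of_continuous
    ((Complex.continuous_ofReal.comp (continuous_pk hz)).mul hc))
  simpa using this

end BoundaryFlat

namespace BoundaryFlat

open scoped Real Topology

theorem exists_entire_of_mem_span_fourier [Fact (0 < 2 * π)] (q : C(AddCircle (2 * π), ℂ))
    (hq : q ∈ Submodule.span ℂ (range (fourier (T := 2 * π)))) :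
    ∃ p₁ p₂ : ℂ → ℂ, Differentiable ℂ p₁ ∧ Differentiable ℂ p₂ ∧
      ∀ θ : ℝ, q θ = p₁ (circleMap 0 1 θ) + starRingEnd ℂ (p₂ (circleMap 0 1 θ)) := by
  induction hq using Submodule.span_induction with
  | mem x hx =>
    obtain ⟨n, rfl⟩ := hx
    have key : ∀ (m : ℕ) (θ : ℝ), fourier (T := 2 * π) m (θ : AddCircle (2 * π)) =
        circleMap 0 1 θ ^ m := fun m θ => by
      rw [fourier_coe_apply, circleMap, zero_add, Complex.ofReal_one, one_mul, ← Complex.exp_nat_mul]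
      congr 1
      push_cast
      field_simp
    obtain ⟨m, rfl | rfl⟩ := Int.eq_nat_or_neg n
    · exact ⟨fun z => z ^ m, fun _ => 0, by fun_prop, by fun_prop, fun θ => by simp [key]⟩
    · exact ⟨fun _ => 0, fun z => z ^ m, by fun_prop, by fun_prop, fun θ => by
        rw [fourier_neg, key]; simp⟩
  | zero => exact ⟨fun _ => 0, fun _ => 0, by fun_prop, by fun_prop, by simp⟩
  | add x y _ _ hx hy =>
    obtain ⟨a, b, ha, hb, h⟩ := hx
    obtain ⟨c, d, hc, hd, h'⟩ := hy
    exact ⟨fun z => a z + c z, fun z => b z + d z, by fun_prop, by fun_prop, fun θ => by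
      rw [ContinuousMap.add_apply, h, h', map_add]; ring⟩
  | smul c x _ hx =>
    obtain ⟨a, b, ha, hb, h⟩ := hx
    exact ⟨fun z => c * a z, fun z => starRingEnd ℂ c * b z, by fun_prop, by fun_prop, fun θ => by
      rw [ContinuousMap.smul_apply, h, map_mul, smul_eq_mul, Complex.conj_conj]; ring⟩

/-- Continuous functions on the circle are uniform limits of real parts of entire functions. -/
theorem exists_entire_re_near {ψ : ℝ → ℝ} (hψ : Continuous ψ) (hper : Function.Periodic ψ (2 * π))
    {ε : ℝ} (hε : 0 < ε) :
    ∃ p : ℂ → ℂ, Differentiable ℂ p ∧ ∀ θ : ℝ, |(p (circleMap 0 1 θ)).re - ψ θ| ≤ ε := by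
  have : Fact (0 < 2 * π) := ⟨by positivity⟩
  let Ψ : C(AddCircle (2 * π), ℂ) := ⟨fun x => (hper.lift x : ℂ),
    Complex.continuous_ofReal.comp (continuous_quot_lift _ hψ)⟩
  have h : Ψ ∈ (Submodule.span ℂ (range (fourier (T := 2 * π)))).topologicalClosure := by
    rw [span_fourier_closure_eq_top]; trivial
  obtain ⟨q, hq, hd⟩ := Metric.mem_closure_iff.1 h ε hε
  obtain ⟨a, b, ha, hb, hab⟩ := exists_entire_of_mem_span_fourier q hq
  refine ⟨fun z => a z + b z, by fun_prop, fun θ => ?_⟩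
  have h1 := (ContinuousMap.dist_apply_le_dist (f := Ψ) (g := q) (θ : AddCircle (2 * π))).trans hd.le
  rw [dist_comm, dist_eq_norm, hab] at h1
  have h2 := (Complex.abs_re_le_norm _).trans h1
  simpa [Ψ] using h2

/-- A subharmonic majorant principle for the modulus of an analytic function. -/
theorem log_norm_le_integral_pk_of_le {f : ℂ → ℂ} (hf : DiffContOnCl ℂ f (ball 0 1))
    {ψ : ℝ → ℝ} (hψ : Continuous ψ) (hper : Function.Periodic ψ (2 * π))
    (hle : ∀ θ, ‖f (circleMap 0 1 θ)‖ ≤ Real.exp (ψ θ)) {z : ℂ} (hz : ‖z‖ < 1) (hfz : f z ≠ 0) :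
    Real.log ‖f z‖ ≤ ∫ θ, pk z θ * ψ θ ∂circProb := by
  refine le_of_forall_pos_le_add fun ε hε => ?_
  obtain ⟨p, hp, hpψ⟩ := exists_entire_re_near hψ hper (half_pos hε)
  have hbd : ∀ w ∈ frontier (ball (0:ℂ) 1), ‖f w * Complex.exp (-p w)‖ ≤ Real.exp (ε / 2) := by
    intro w hw
    rw [frontier_ball _ one_ne_zero] at hw
    obtain ⟨θ, -, rfl⟩ : w ∈ circleMap 0 1 '' Ioc 0 (2 * π) := by
      rw [image_circleMap_Ioc]; simpa using hw
    rw [norm_mul, Complex.norm_exp]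
    calc _ ≤ Real.exp (ψ θ) * Real.exp ((-p (circleMap 0 1 θ)).re) := by
          gcongr; exact hle θ
      _ ≤ _ := by
          rw [← Real.exp_add, Real.exp_le_exp, Complex.neg_re]
          linarith [(abs_le.1 (hpψ θ)).1]
  have hd : DiffContOnCl ℂ (fun w => f w * Complex.exp (-p w)) (ball 0 1) :=
    by
    simpa [mul_comm] using (hp.neg.cexp.diffContOnCl (s := ball 0 1)).smul hf
  have h1 := Complex.norm_le_of_forall_mem_frontier_norm_le isBounded_ball hd hbd
    (z := z) (subset_closure (by simpa using hz))
  rw [norm_mul, Complex.norm_exp, Complex.neg_re] at h1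
  have h2 := Real.log_le_log (by positivity) h1
  rw [Real.log_mul (by positivity) (by positivity), Real.log_exp, Real.log_exp] at h2
  have hpc : Continuous fun θ => p (circleMap 0 1 θ) := hp.continuous.comp (continuous_circleMap 0 1)
  have h3 := integral_pk_mul_re hp.diffContOnCl hpc hz
  have h4 : ∫ θ, pk z θ * (p (circleMap 0 1 θ)).re ∂circProb ≤
      ∫ θ, (pk z θ * ψ θ + pk z θ * (ε / 2)) ∂circProb := by
    refine integral_mono
      (integrable_pk_mul hz (integrable_circProb_of_continuous (Complex.continuous_re.comp hpc)))
      ((integrable_pk_mul hz (integrable_circProb_of_continuous hψ)).add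
        (integrable_pk_mul hz (integrable_const _))) fun θ => ?_
    simp only
    rw [← mul_add]
    exact mul_le_mul_of_nonneg_left (by linarith [(abs_le.1 (hpψ θ)).2]) (pk_nonneg hz θ)
  rw [integral_add (integrable_pk_mul hz (integrable_circProb_of_continuous hψ))
        (integrable_pk_mul hz (integrable_const _)), integral_mul_const, integral_pk hz] at h4
  linarith

end BoundaryFlat

namespace BoundaryFlat

open scoped Real Topology

section LogIntegrable

variable {f : ℂ → ℂ}

theorem lintegral_pk_log_le (hf : DiffContOnCl ℂ f (ball 0 1))
    (hc : Continuous fun θ => f (circleMap 0 1 θ)) {B : ℝ}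
    (hB : ∀ θ, Real.log (max ‖f (circleMap 0 1 θ)‖ 1) ≤ B)
    {z : ℂ} (hz : ‖z‖ < 1) (hfz : f z ≠ 0) :
    ∫⁻ θ, (if f (circleMap 0 1 θ) = 0 then ⊤ else
      ENNReal.ofReal (pk z θ * (B - Real.log ‖f (circleMap 0 1 θ)‖))) ∂circProb ≤
      ENNReal.ofReal (B - Real.log ‖f z‖) := by
  set ψ : ℕ → ℝ → ℝ := fun k θ => Real.log (max ‖f (circleMap 0 1 θ)‖ (1 / ((k:ℝ) + 1))) with hψ
  have hpos : ∀ (k : ℕ) θ, 0 < max ‖f (circleMap 0 1 θ)‖ (1 / ((k:ℝ) + 1)) := fun k θ =>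
    lt_max_of_lt_right (by positivity)
  have hψc : ∀ k, Continuous (ψ k) := fun k =>
    (hc.norm.max continuous_const).log fun θ => (hpos k θ).ne'
  have hψB : ∀ k θ, ψ k θ ≤ B := fun k θ => by
    refine le_trans (Real.log_le_log (hpos k θ) (max_le_max le_rfl ?_)) (hB θ)
    rw [div_le_one (by positivity)]; linarith [(Nat.cast_nonneg k : (0:ℝ) ≤ k)]
  have h_int : ∀ k, Integrable (fun θ => pk z θ * (B - ψ k θ)) circProb := fun k =>
    integrable_pk_mul hz (integrable_circProb_of_continuous (continuous_const.sub (hψc k)))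
  have h1 : ∀ k, ∫⁻ θ, ENNReal.ofReal (pk z θ * (B - ψ k θ)) ∂circProb ≤
      ENNReal.ofReal (B - Real.log ‖f z‖) := fun k => by
    rw [← ofReal_integral_eq_lintegral_ofReal (h_int k)
      (ae_of_all _ fun θ => mul_nonneg (pk_nonneg hz θ) (sub_nonneg.2 (hψB k θ)))]
    apply ENNReal.ofReal_le_ofReal
    have h2 := log_norm_le_integral_pk_of_le hf (hψc k)
      (fun θ => by simp only [hψ, periodic_circleMap 0 1 θ])
      (fun θ => by rw [Real.exp_log (hpos k θ)]; exact le_max_left _ _) hz hfz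
    have h3 : ∫ θ, pk z θ * (B - ψ k θ) ∂circProb = B - ∫ θ, pk z θ * ψ k θ ∂circProb := by
      simp_rw [mul_sub]
      rw [integral_sub (integrable_pk_mul hz (integrable_const _))
        (integrable_pk_mul hz (integrable_circProb_of_continuous (hψc k))),
        integral_mul_const, integral_pk hz, one_mul]
    rw [h3]; linarith
  calc _ ≤ ∫⁻ θ, liminf (fun k => ENNReal.ofReal (pk z θ * (B - ψ k θ))) atTop ∂circProb := by
        refine lintegral_mono fun θ => ?_
        have hinv : Tendsto (fun k : ℕ => 1 / ((k:ℝ) + 1)) atTop (𝓝 0) :=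
          tendsto_one_div_add_atTop_nhds_zero_nat
        split_ifs with h0
        · have hpkpos : 0 < pk z θ := div_pos (one_sub_sq_pos hz)
            (pow_pos (circleMap_sub_pos hz θ) 2)
          have hlog : Tendsto (fun k => ψ k θ) atTop atBot := by
            have : ∀ k, ψ k θ = Real.log (1 / ((k:ℝ) + 1)) := fun k => by
              simp only [hψ, h0, norm_zero]
              rw [max_eq_right (by positivity)]
            simp_rw [this]
            exact Real.tendsto_log_nhdsGT_zero.comp
              (tendsto_nhdsWithin_iff.2 ⟨hinv, Eventually.of_forall fun k => by
                simp only [mem_Ioi]; positivity⟩)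
          have h4 : Tendsto (fun k => pk z θ * (B - ψ k θ)) atTop atTop :=
            (tendsto_atTop_add_const_left _ B (tendsto_neg_atBot_atTop.comp hlog)).const_mul_atTop
              hpkpos
          exact (ENNReal.tendsto_ofReal_atTop.comp h4).liminf_eq.ge
        · have h4 : Tendsto (fun k => ENNReal.ofReal (pk z θ * (B - ψ k θ))) atTop
              (𝓝 (ENNReal.ofReal (pk z θ * (B - Real.log ‖f (circleMap 0 1 θ)‖)))) := by
            refine tendsto_const_nhds.congr' ?_
            filter_upwards [hinv.eventually (gt_mem_nhds (norm_pos_iff.2 h0))] with k hk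
            simp only [hψ, max_eq_left hk.le]
          rw [h4.liminf_eq]
    _ ≤ liminf (fun k => ∫⁻ θ, ENNReal.ofReal (pk z θ * (B - ψ k θ)) ∂circProb) atTop :=
        lintegral_liminf_le fun k => ((continuous_pk hz).mul
          (continuous_const.sub (hψc k))).measurable.ennreal_ofReal
    _ ≤ _ := liminf_le_of_le (by isBoundedDefault) fun b hb => by
        obtain ⟨k, hk⟩ := hb.exists
        exact hk.trans (h1 k)

theorem exists_log_bound (hS : ∃ S : ℝ, ∀ θ, ‖f (circleMap 0 1 θ)‖ ≤ S) :
    ∃ B, ∀ θ, Real.log (max ‖f (circleMap 0 1 θ)‖ 1) ≤ B := by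
  obtain ⟨S, hS⟩ := hS
  exact ⟨Real.log (max S 1), fun θ => Real.log_le_log (by positivity) (max_le_max (hS θ) le_rfl)⟩

variable (hf : DiffContOnCl ℂ f (ball 0 1)) (hc : Continuous fun θ => f (circleMap 0 1 θ))
  (hS : ∃ S : ℝ, ∀ θ, ‖f (circleMap 0 1 θ)‖ ≤ S)

include hf hc hS

theorem ae_boundary_ne_zero {z : ℂ} (hz : ‖z‖ < 1) (hfz : f z ≠ 0) :
    ∀ᵐ θ ∂circProb, f (circleMap 0 1 θ) ≠ 0 := by
  obtain ⟨B, hB⟩ := exists_log_bound hS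
  have h := lintegral_pk_log_le hf hc hB hz hfz
  have hm : MeasurableSet {θ | f (circleMap 0 1 θ) = 0} := (isClosed_singleton.preimage hc).measurableSet
  have hm' : Measurable fun θ => (if f (circleMap 0 1 θ) = 0 then (⊤ : ℝ≥0∞) else
      ENNReal.ofReal (pk z θ * (B - Real.log ‖f (circleMap 0 1 θ)‖))) :=
    Measurable.ite hm measurable_const ((continuous_pk hz).measurable.mul
      (measurable_const.sub hc.norm.measurable.log)).ennreal_ofReal
  filter_upwards [ae_lt_top hm' (h.trans_lt ENNReal.ofReal_lt_top).ne] with θ hθ h0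
  simp [h0] at hθ

theorem integrable_pk_log_aux {z : ℂ} (hz : ‖z‖ < 1) (hfz : f z ≠ 0) {B : ℝ}
    (hB : ∀ θ, Real.log (max ‖f (circleMap 0 1 θ)‖ 1) ≤ B) :
    Integrable (fun θ => pk z θ * (B - Real.log ‖f (circleMap 0 1 θ)‖)) circProb ∧
    (∀ᵐ θ ∂circProb, 0 ≤ pk z θ * (B - Real.log ‖f (circleMap 0 1 θ)‖)) ∧
    ∫ θ, pk z θ * (B - Real.log ‖f (circleMap 0 1 θ)‖) ∂circProb ≤ B - Real.log ‖f z‖ := by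
  have h := lintegral_pk_log_le hf hc hB hz hfz
  have hne := ae_boundary_ne_zero hf hc hS hz hfz
  have hnn : ∀ᵐ θ ∂circProb, 0 ≤ pk z θ * (B - Real.log ‖f (circleMap 0 1 θ)‖) := by
    filter_upwards [hne] with θ hθ
    exact mul_nonneg (pk_nonneg hz θ) (sub_nonneg.2
      ((Real.log_le_log (norm_pos_iff.2 hθ) (le_max_left _ _)).trans (hB θ)))
  have hmeas : AEStronglyMeasurable (fun θ => pk z θ * (B - Real.log ‖f (circleMap 0 1 θ)‖))
      circProb := ((continuous_pk hz).measurable.mul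
      (measurable_const.sub hc.norm.measurable.log)).aestronglyMeasurable
  have h2 : ∫⁻ θ, ENNReal.ofReal (pk z θ * (B - Real.log ‖f (circleMap 0 1 θ)‖)) ∂circProb ≤
      ENNReal.ofReal (B - Real.log ‖f z‖) := by
    refine le_trans (lintegral_mono_ae ?_) h
    filter_upwards [hne] with θ hθ
    rw [if_neg hθ]
  have h_int : Integrable (fun θ => pk z θ * (B - Real.log ‖f (circleMap 0 1 θ)‖)) circProb :=
    (lintegral_ofReal_ne_top_iff_integrable hmeas hnn).1 (h2.trans_lt ENNReal.ofReal_lt_top).ne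
  refine ⟨h_int, hnn, ?_⟩
  rw [← ofReal_integral_eq_lintegral_ofReal h_int hnn] at h2
  have hle : Real.log ‖f z‖ ≤ B := by
    have hcB : ∀ θ, ‖f (circleMap 0 1 θ)‖ ≤ Real.exp B := fun θ =>
      (le_max_left _ _).trans ((Real.log_le_iff_le_exp (by positivity)).1 (hB θ))
    have := log_norm_le_integral_pk_of_le hf continuous_const (ψ := fun _ => B)
      (fun _ => rfl) hcB hz hfz
    rwa [integral_mul_const, integral_pk hz, one_mul] at this
  exact (ENNReal.ofReal_le_ofReal_iff (sub_nonneg.2 hle)).1 h2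

theorem integrable_log_norm {z : ℂ} (hz : ‖z‖ < 1) (hfz : f z ≠ 0) :
    Integrable (fun θ => Real.log ‖f (circleMap 0 1 θ)‖) circProb := by
  obtain ⟨B, hB⟩ := exists_log_bound hS
  obtain ⟨h1, h2, -⟩ := integrable_pk_log_aux hf hc hS hz hfz hB
  have h3 : Integrable (fun θ => B - Real.log ‖f (circleMap 0 1 θ)‖) circProb := by
    refine (h1.const_mul (4 / (1 - ‖z‖ ^ 2))).mono'
      (measurable_const.sub hc.norm.measurable.log).aestronglyMeasurable ?_
    filter_upwards [h2] with θ hθ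
    have hp := one_sub_sq_pos hz
    have hd := circleMap_sub_pos hz θ
    have hd2 : ‖circleMap 0 1 θ - z‖ ≤ 2 := (norm_sub_le _ _).trans (by
      rw [norm_circleMap_one]; linarith)
    have hpk : 0 < pk z θ := div_pos hp (pow_pos hd 2)
    have hnn : 0 ≤ B - Real.log ‖f (circleMap 0 1 θ)‖ := nonneg_of_mul_nonneg_right hθ hpk
    rw [Real.norm_of_nonneg hnn, ← mul_assoc]
    refine le_mul_of_one_le_left hnn ?_
    rw [pk, div_mul_div_comm, mul_comm, mul_div_mul_left _ _ hp.ne', one_le_div (by positivity)]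
    nlinarith
  refine ((integrable_const B).sub h3).congr (ae_of_all _ fun θ => ?_)
  simp

/-- The Poisson–Jensen inequality. -/
theorem log_norm_le_integral_pk {z : ℂ} (hz : ‖z‖ < 1) (hfz : f z ≠ 0) :
    Real.log ‖f z‖ ≤ ∫ θ, pk z θ * Real.log ‖f (circleMap 0 1 θ)‖ ∂circProb := by
  obtain ⟨B, hB⟩ := exists_log_bound hS
  obtain ⟨-, -, h⟩ := integrable_pk_log_aux hf hc hS hz hfz hB
  simp_rw [mul_sub] at h
  rw [integral_sub (integrable_pk_mul hz (integrable_const _))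
    (integrable_pk_mul hz (integrable_log_norm hf hc hS hz hfz)), integral_mul_const,
    integral_pk hz] at h
  linarith

end LogIntegrable

end BoundaryFlat

namespace BoundaryFlat

open scoped Real Topology

section Herglotz

/-- The Herglotz transform of a real function on the unit circle. -/
noncomputable def herglotz (V : ℂ → ℝ) (z : ℂ) : ℂ :=
  Real.circleAverage (fun ζ => herglotzRieszKernel 0 z ζ • (V ζ : ℂ)) 0 1

variable {V : ℂ → ℝ} {z : ℂ}

theorem circleIntegrable_ofReal (hV : Integrable (fun θ => V (circleMap 0 1 θ)) circProb) :
    CircleIntegrable (fun ζ => (V ζ : ℂ)) 0 1 :=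
  (circleIntegrable_iff_integrable _).2 hV.ofReal

theorem integral_inv_sq_kernel (z : ℂ) :
    ∫ θ, 2 * circleMap 0 1 θ / (circleMap 0 1 θ - z) ^ 2 ∂circProb = 0 := by
  rw [← circleAverage_eq_integral (fun ζ => 2 * ζ / (ζ - z) ^ 2),
    Real.circleAverage_eq_circleIntegral one_ne_zero]
  have h : ∮ ζ in C(0, 1), (ζ - z) ^ (-2 : ℤ) = 0 :=
    circleIntegral.integral_sub_zpow_of_ne (by norm_num) 0 z 1
  have h2 : ∮ ζ in C(0, 1), (ζ - 0)⁻¹ • (2 * ζ / (ζ - z) ^ 2) =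
      ∮ ζ in C(0, 1), 2 • (ζ - z) ^ (-2 : ℤ) := by
    refine circleIntegral.integral_congr zero_le_one fun ζ hζ => ?_
    have h0 : ζ ≠ 0 := by rintro rfl; simp at hζ
    simp only [sub_zero, smul_eq_mul]
    rw [zpow_neg, nsmul_eq_mul, zpow_ofNat]
    field_simp
    norm_num
  rw [h2]
  simp only [nsmul_eq_mul]
  rw [circleIntegral.integral_const_mul, h]
  simp

theorem hasDerivAt_herglotz (hV : Integrable (fun θ => V (circleMap 0 1 θ)) circProb)
    (hz : ‖z‖ < 1) : HasDerivAt (herglotz V)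
      (∫ θ, 2 * circleMap 0 1 θ / (circleMap 0 1 θ - z) ^ 2 * (V (circleMap 0 1 θ) : ℂ)
        ∂circProb) z := by
  have h := hasDerivAt_circleAverage_herglotzRieszKernel_smul (circleIntegrable_ofReal hV)
    (w := z) (by simpa using hz)
  rw [circleAverage_eq_integral (fun ζ => (2 * ζ / (ζ - z) ^ 2) • (V ζ : ℂ))] at h
  exact h

theorem re_herglotz (hV : Integrable (fun θ => V (circleMap 0 1 θ)) circProb)
    (hz : ‖z‖ < 1) : (herglotz V z).re = ∫ θ, pk z θ * V (circleMap 0 1 θ) ∂circProb := by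
  have h := re_circleAverage_herglotzRieszKernel_smul
    ((circleIntegrable_iff_integrable V).2 hV) (w := z) (by simpa using hz)
  rw [herglotz, h, circleAverage_eq_integral, ← poissonKernel_eq_re_herglotzRieszKernel]
  simp [poissonKernel_def, pk]

theorem norm_inv_sq_kernel (hz : ‖z‖ < 1) (θ : ℝ) :
    ‖2 * circleMap 0 1 θ / (circleMap 0 1 θ - z) ^ 2‖ = 2 / (1 - ‖z‖ ^ 2) * pk z θ := by
  have := (one_sub_sq_pos hz).ne'
  rw [pk, norm_div, norm_mul, norm_circleMap_one, norm_pow]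
  simp
  field_simp

theorem norm_herglotz_le (hV : Integrable (fun θ => V (circleMap 0 1 θ)) circProb)
    (hz : ‖z‖ < 1) :
    ‖herglotz V z‖ ≤ 2 / (1 - ‖z‖) * ∫ θ, |V (circleMap 0 1 θ)| ∂circProb := by
  rw [herglotz, circleAverage_eq_integral, ← integral_const_mul]
  refine norm_integral_le_of_norm_le (hV.abs.const_mul _) (ae_of_all _ fun θ => ?_)
  rw [norm_smul, norm_real, Real.norm_eq_abs]
  gcongr
  rw [herglotzRieszKernel_def, norm_div, sub_zero, sub_zero]
  have h1 := one_sub_norm_le z θ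
  have : ‖circleMap 0 1 θ + z‖ ≤ 2 := (norm_add_le _ _).trans (by
    rw [norm_circleMap_one]; linarith)
  have : 0 < 1 - ‖z‖ := by linarith
  gcongr

theorem norm_deriv_herglotz_le (hV : Integrable (fun θ => V (circleMap 0 1 θ)) circProb)
    (hz : ‖z‖ < 1) (c : ℝ) :
    ‖deriv (herglotz V) z‖ ≤
      2 / (1 - ‖z‖ ^ 2) * ∫ θ, pk z θ * |V (circleMap 0 1 θ) - c| ∂circProb := by
  have hk : Continuous fun θ => 2 * circleMap 0 1 θ / (circleMap 0 1 θ - z) ^ 2 := by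
    have : ∀ θ : ℝ, (circleMap 0 1 θ - z) ^ 2 ≠ 0 := fun θ =>
      pow_ne_zero 2 (norm_pos_iff.1 (circleMap_sub_pos hz θ))
    fun_prop (disch := assumption)
  have hVc : Integrable (fun θ => V (circleMap 0 1 θ) - c) circProb :=
    hV.sub (integrable_const _)
  have hkV : Integrable (fun θ => 2 * circleMap 0 1 θ / (circleMap 0 1 θ - z) ^ 2 *
      (V (circleMap 0 1 θ) : ℂ)) circProb := by
    refine hV.ofReal.bdd_mul (c := 2 / (1 - ‖z‖ ^ 2) * (2 / (1 - ‖z‖)))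
      hk.aestronglyMeasurable (ae_of_all _ fun θ => ?_)
    rw [norm_inv_sq_kernel hz]
    have := (one_sub_sq_pos hz).le
    gcongr
    exact pk_le hz θ
  rw [(hasDerivAt_herglotz hV hz).deriv, ← integral_const_mul]
  have e : ∫ θ, 2 * circleMap 0 1 θ / (circleMap 0 1 θ - z) ^ 2 * (V (circleMap 0 1 θ) : ℂ)
      ∂circProb = ∫ θ, 2 * circleMap 0 1 θ / (circleMap 0 1 θ - z) ^ 2 *
        ((V (circleMap 0 1 θ) - c : ℝ) : ℂ) ∂circProb := by
    push_cast
    simp_rw [mul_sub]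
    rw [integral_sub hkV ((integrable_circProb_of_continuous hk).mul_const _),
      integral_mul_const, integral_inv_sq_kernel z, zero_mul, sub_zero]
  rw [e]
  refine norm_integral_le_of_norm_le ((integrable_pk_mul hz hVc.abs).const_mul _)
    (ae_of_all _ fun θ => ?_)
  rw [norm_mul, norm_inv_sq_kernel hz, norm_real, Real.norm_eq_abs, mul_assoc]

theorem norm_deriv_herglotz_le_one_sub
    (hV : Integrable (fun θ => V (circleMap 0 1 θ)) circProb) (hz : ‖z‖ < 1) :
    ‖deriv (herglotz V) z‖ ≤
      2 / (1 - ‖z‖ ^ 2) * (2 / (1 - ‖z‖) * ∫ θ, |V (circleMap 0 1 θ)| ∂circProb) := by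
  refine (norm_deriv_herglotz_le hV hz 0).trans ?_
  have := (one_sub_sq_pos hz).le
  gcongr
  rw [← integral_const_mul]
  refine integral_mono (integrable_pk_mul hz (by simpa using hV.abs)) (hV.abs.const_mul _)
    fun θ => ?_
  simp only [sub_zero]
  gcongr
  exact pk_le hz θ

end Herglotz

end BoundaryFlat

namespace BoundaryFlat

open scoped Real Topology

/-- The Poisson average of the oscillation of `f` around its value at `z`. -/
noncomputable def osc (f : ℂ → ℂ) (z : ℂ) : ℝ :=
  ∫ θ, pk z θ * ‖f (circleMap 0 1 θ) - f z‖ ∂circProb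

/-- The logarithm of the boundary modulus `min 1 (c * ‖f‖) ^ N`. -/
noncomputable def cutLog (f : ℂ → ℂ) (N c : ℝ) (ζ : ℂ) : ℝ := N * min 0 (Real.log (c * ‖f ζ‖))

section CutLog

variable {f : ℂ → ℂ} {N c : ℝ} {z : ℂ}

theorem osc_nonneg (hz : ‖z‖ < 1) : 0 ≤ osc f z :=
  integral_nonneg fun θ => mul_nonneg (pk_nonneg hz θ) (norm_nonneg _)

theorem cutLog_nonpos (hN : 0 ≤ N) (ζ : ℂ) : cutLog f N c ζ ≤ 0 :=
  mul_nonpos_of_nonneg_of_nonpos hN (min_le_left _ _)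

theorem abs_cutLog_le (hN : 0 ≤ N) (hc1 : 1 ≤ c) (ζ : ℂ) :
    |cutLog f N c ζ| ≤ N * |Real.log ‖f ζ‖| := by
  rw [cutLog, abs_mul, abs_of_nonneg hN]
  refine mul_le_mul_of_nonneg_left ?_ hN
  by_cases h0 : f ζ = 0
  · simp [h0]
  have h1 : 0 < ‖f ζ‖ := norm_pos_iff.2 h0
  rw [Real.log_mul (by linarith) h1.ne', abs_of_nonpos (min_le_left _ _)]
  have h2 := Real.log_nonneg hc1
  rcases min_cases 0 (Real.log c + Real.log ‖f ζ‖) with ⟨h, -⟩ | ⟨h, -⟩ <;> rw [h]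
  · simp
  · linarith [neg_le_abs (Real.log ‖f ζ‖)]

theorem abs_cutLog_sub_le (hN : 0 ≤ N) (hc1 : 1 ≤ c) {ζ : ℂ} (hζ : f ζ ≠ 0) (hz : f z ≠ 0) :
    |cutLog f N c ζ - cutLog f N c z| ≤ N * |Real.log ‖f ζ‖ - Real.log ‖f z‖| := by
  rw [cutLog, cutLog, ← mul_sub, abs_mul, abs_of_nonneg hN]
  refine mul_le_mul_of_nonneg_left ?_ hN
  refine (abs_min_sub_min_le_max _ _ _ _).trans ?_
  rw [Real.log_mul (by linarith) (norm_pos_iff.2 hζ).ne',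
    Real.log_mul (by linarith) (norm_pos_iff.2 hz).ne']
  simp

theorem tendsto_cutLog (ζ : ℂ) : Tendsto (fun n : ℕ => cutLog f N (n + 1) ζ) atTop (𝓝 0) := by
  by_cases h0 : f ζ = 0
  · simp [cutLog, h0]
  have h1 : 0 < ‖f ζ‖ := norm_pos_iff.2 h0
  obtain ⟨k, hk⟩ := exists_nat_ge (1 / ‖f ζ‖)
  refine tendsto_const_nhds.congr' ?_
  filter_upwards [eventually_ge_atTop k] with n hn
  have h2 : 1 ≤ ((n:ℝ) + 1) * ‖f ζ‖ := by
    rw [div_le_iff₀ h1] at hk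
    have : (k:ℝ) ≤ n := by exact_mod_cast hn
    nlinarith
  rw [cutLog, min_eq_left (Real.log_nonneg h2), mul_zero]

variable (hf : DiffContOnCl ℂ f (ball 0 1)) (hc : Continuous fun θ => f (circleMap 0 1 θ))
  (hS : ∃ S : ℝ, ∀ θ, ‖f (circleMap 0 1 θ)‖ ≤ S)

include hc in
theorem measurable_cutLog : Measurable fun θ => cutLog f N c (circleMap 0 1 θ) := by
  unfold cutLog
  exact measurable_const.mul (measurable_const.min (measurable_const.mul hc.norm.measurable).log)

include hc in
theorem integrable_pk_mul_norm_sub (hz : ‖z‖ < 1) :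
    Integrable (fun θ => pk z θ * ‖f (circleMap 0 1 θ) - f z‖) circProb :=
  integrable_pk_mul hz (integrable_circProb_of_continuous (hc.sub continuous_const).norm)

include hf hc hS

theorem integrable_cutLog (hN : 0 ≤ N) (hc1 : 1 ≤ c) (hz : ‖z‖ < 1) (hfz : f z ≠ 0) :
    Integrable (fun θ => cutLog f N c (circleMap 0 1 θ)) circProb :=
  ((integrable_log_norm hf hc hS hz hfz).abs.const_mul N).mono'
    (measurable_cutLog hc).aestronglyMeasurable (ae_of_all _ fun _ => abs_cutLog_le hN hc1 _)

theorem tendsto_integral_cutLog (hN : 0 ≤ N) (hz : ‖z‖ < 1) (hfz : f z ≠ 0) :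
    Tendsto (fun n : ℕ => ∫ θ, |cutLog f N (n + 1) (circleMap 0 1 θ)| ∂circProb) atTop (𝓝 0) := by
  have := tendsto_integral_of_dominated_convergence (μ := circProb)
    (F := fun (n : ℕ) θ => |cutLog f N (n + 1) (circleMap 0 1 θ)|) (f := fun _ => 0)
    (fun θ => N * |Real.log ‖f (circleMap 0 1 θ)‖|)
    (fun n => (measurable_cutLog hc).abs.aestronglyMeasurable)
    ((integrable_log_norm hf hc hS hz hfz).abs.const_mul N)
    (fun n => ae_of_all _ fun θ => by
      rw [Real.norm_eq_abs, abs_abs]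
      exact abs_cutLog_le hN (by linarith [(Nat.cast_nonneg n : (0:ℝ) ≤ n)]) _)
    (ae_of_all _ fun θ => by simpa using (tendsto_cutLog (f := f) (N := N) (circleMap 0 1 θ)).abs)
  simpa using this

theorem integral_pk_abs_log_sub_le (hz : ‖z‖ < 1) (hfz : f z ≠ 0) :
    ∫ θ, pk z θ * |Real.log ‖f (circleMap 0 1 θ)‖ - Real.log ‖f z‖| ∂circProb ≤
      2 * osc f z / ‖f z‖ := by
  have hlog := integrable_log_norm hf hc hS hz hfz
  have hi1 : Integrable (fun θ => pk z θ * (Real.log ‖f (circleMap 0 1 θ)‖ - Real.log ‖f z‖))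
      circProb := integrable_pk_mul hz (hlog.sub (integrable_const _))
  have hi2 := (integrable_pk_mul_norm_sub hc hz).const_mul (2 / ‖f z‖)
  have hpos : 0 < ‖f z‖ := norm_pos_iff.2 hfz
  have hJ := log_norm_le_integral_pk hf hc hS hz hfz
  have h0 : 0 ≤ ∫ θ, pk z θ * (Real.log ‖f (circleMap 0 1 θ)‖ - Real.log ‖f z‖) ∂circProb := by
    simp_rw [mul_sub]
    rw [integral_sub (integrable_pk_mul hz hlog) (integrable_pk_mul hz (integrable_const _)),
      integral_mul_const, integral_pk hz]
    linarith
  calc _ ≤ ∫ θ, (2 / ‖f z‖ * (pk z θ * ‖f (circleMap 0 1 θ) - f z‖) -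
        pk z θ * (Real.log ‖f (circleMap 0 1 θ)‖ - Real.log ‖f z‖)) ∂circProb := by
        refine integral_mono_ae (integrable_pk_mul hz (hlog.sub (integrable_const _)).abs)
          (hi2.sub hi1) ?_
        filter_upwards [ae_boundary_ne_zero hf hc hS hz hfz] with θ hθ
        have hθ' : 0 < ‖f (circleMap 0 1 θ)‖ := norm_pos_iff.2 hθ
        have h1 : Real.log ‖f (circleMap 0 1 θ)‖ - Real.log ‖f z‖ ≤
            ‖f (circleMap 0 1 θ) - f z‖ / ‖f z‖ := by
          rw [← Real.log_div hθ'.ne' hpos.ne']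
          refine (Real.log_le_sub_one_of_pos (by positivity)).trans ?_
          rw [div_sub_one hpos.ne']
          gcongr
          exact norm_sub_norm_le _ _
        have h2 : |Real.log ‖f (circleMap 0 1 θ)‖ - Real.log ‖f z‖| ≤
            2 * (‖f (circleMap 0 1 θ) - f z‖ / ‖f z‖) -
              (Real.log ‖f (circleMap 0 1 θ)‖ - Real.log ‖f z‖) := by
          have : 0 ≤ ‖f (circleMap 0 1 θ) - f z‖ / ‖f z‖ := by positivity
          rw [abs_le]
          constructor <;> linarith
        refine (mul_le_mul_of_nonneg_left h2 (pk_nonneg hz θ)).trans (le_of_eq ?_)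
        ring
    _ ≤ _ := by
        rw [integral_sub hi2 hi1, integral_const_mul, ← osc]
        have : 2 / ‖f z‖ * osc f z = 2 * osc f z / ‖f z‖ := by ring
        linarith

theorem norm_mul_deriv_herglotz_le (hN : 0 ≤ N) (hc1 : 1 ≤ c) (hz : ‖z‖ < 1) :
    ‖f z * deriv (herglotz (cutLog f N c)) z‖ ≤ 4 * N * (osc f z / (1 - ‖z‖ ^ 2)) := by
  have hp := one_sub_sq_pos hz
  by_cases hfz : f z = 0
  · rw [hfz, zero_mul, norm_zero]
    have := osc_nonneg (f := f) hz
    positivity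
  have hpos : 0 < ‖f z‖ := norm_pos_iff.2 hfz
  have hV := integrable_cutLog hf hc hS hN hc1 hz hfz
  have hlog := integrable_log_norm hf hc hS hz hfz
  have h1 := norm_deriv_herglotz_le hV hz (cutLog f N c z)
  have h2 : ∫ θ, pk z θ * |cutLog f N c (circleMap 0 1 θ) - cutLog f N c z| ∂circProb ≤
      N * (2 * osc f z / ‖f z‖) := by
    refine le_trans ?_ (mul_le_mul_of_nonneg_left (integral_pk_abs_log_sub_le hf hc hS hz hfz) hN)
    rw [← integral_const_mul]
    refine integral_mono_ae (integrable_pk_mul hz (hV.sub (integrable_const _)).abs)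
      ((integrable_pk_mul hz (hlog.sub (integrable_const _)).abs).const_mul N) ?_
    filter_upwards [ae_boundary_ne_zero hf hc hS hz hfz] with θ hθ
    refine (mul_le_mul_of_nonneg_left (abs_cutLog_sub_le hN hc1 hθ hfz) (pk_nonneg hz θ)).trans
      (le_of_eq ?_)
    ring
  rw [norm_mul]
  calc _ ≤ ‖f z‖ * (2 / (1 - ‖z‖ ^ 2) * (N * (2 * osc f z / ‖f z‖))) := by
        gcongr
        exact h1.trans (by gcongr)
    _ = _ := by field_simp; ring

theorem integral_pk_cutLog_le {z₀ : ℂ} (hN : 0 ≤ N) (hc1 : 1 ≤ c) (hz : ‖z‖ < 1) (hz₀ : ‖z₀‖ < 1)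
    (hfz₀ : f z₀ ≠ 0) {a : ℝ} (ha : 0 < a) (hle : c * (‖f z‖ + osc f z) ≤ a) :
    ∫ θ, pk z θ * cutLog f N c (circleMap 0 1 θ) ∂circProb ≤ N * Real.log a := by
  have hV := integrable_cutLog hf hc hS hN hc1 hz₀ hfz₀
  have hi := integrable_pk_mul_norm_sub hc hz
  calc _ ≤ ∫ θ, (pk z θ * (N * (Real.log a - 1 + c * ‖f z‖ / a)) +
        N * c / a * (pk z θ * ‖f (circleMap 0 1 θ) - f z‖)) ∂circProb := by
        refine integral_mono_ae (integrable_pk_mul hz hV)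
          ((integrable_pk_mul hz (integrable_const _)).add (hi.const_mul _)) ?_
        filter_upwards [ae_boundary_ne_zero hf hc hS hz₀ hfz₀] with θ hθ
        have hθ' : 0 < c * ‖f (circleMap 0 1 θ)‖ := mul_pos (by linarith) (norm_pos_iff.2 hθ)
        have h1 : cutLog f N c (circleMap 0 1 θ) ≤
            N * (Real.log a - 1 + c * ‖f z‖ / a + c / a * ‖f (circleMap 0 1 θ) - f z‖) := by
          refine mul_le_mul_of_nonneg_left ((min_le_right _ _).trans ?_) hN
          have h2 := Real.log_le_sub_one_of_pos (div_pos hθ' ha)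
          rw [Real.log_div hθ'.ne' ha.ne'] at h2
          have h3 : c * ‖f (circleMap 0 1 θ)‖ / a ≤
              c * ‖f z‖ / a + c / a * ‖f (circleMap 0 1 θ) - f z‖ := by
            rw [div_mul_eq_mul_div, ← add_div, ← mul_add]
            have := norm_le_norm_add_norm_sub' (f (circleMap 0 1 θ)) (f z)
            gcongr
          linarith
        refine (mul_le_mul_of_nonneg_left h1 (pk_nonneg hz θ)).trans (le_of_eq ?_)
        ring
    _ = N * (Real.log a - 1 + c * (‖f z‖ + osc f z) / a) := by
        rw [integral_add (integrable_pk_mul hz (integrable_const _)) (hi.const_mul _),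
          integral_mul_const, integral_pk hz, integral_const_mul, ← osc]
        ring
    _ ≤ _ := by
        have : c * (‖f z‖ + osc f z) / a ≤ 1 := (div_le_one ha).2 hle
        nlinarith

end CutLog

end BoundaryFlat

namespace BoundaryFlat

open scoped Real Topology

section KernelIntegrals

theorem lintegral_comp_abs_le (G : ℝ → ℝ≥0∞) (hG : Measurable G) :
    ∫⁻ θ : ℝ, G |θ| ≤ 2 * ∫⁻ θ in Ioi 0, G θ := by
  have h1 : ∫⁻ θ in Ioi (0:ℝ), G |θ| = ∫⁻ θ in Ioi (0:ℝ), G θ :=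
    setLIntegral_congr_fun measurableSet_Ioi fun θ hθ => by
      rw [abs_of_pos (mem_Ioi.1 hθ)]
  have h2 : ∫⁻ θ in Iio (0:ℝ), G |θ| = ∫⁻ θ in Ioi (0:ℝ), G |θ| := by
    have := (Measure.measurePreserving_neg (volume : Measure ℝ)).setLIntegral_comp_preimage
      (measurableSet_Ioi (a := (0:ℝ))) (f := fun θ => G |θ|) (hG.comp measurable_norm)
    simpa using this
  have h3 : ∫⁻ θ : ℝ, G |θ| = (∫⁻ θ in Iio (0:ℝ), G |θ|) + ∫⁻ θ in Ici (0:ℝ), G |θ| := by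
    rw [← lintegral_add_compl _ (measurableSet_Iio (a := (0:ℝ))), compl_Iio]
  rw [h3, setLIntegral_congr (Ioi_ae_eq_Ici (a := (0:ℝ))).symm, h2, h1, two_mul]

theorem lintegral_min_rpow_le {s k : ℝ} (hs0 : 0 < s) (hs1 : s < 1) (hk : 0 < k) :
    ∫⁻ t in Ioi (0:ℝ), ENNReal.ofReal (min (t ^ (-(s + 1))) (k * t ^ (-s))) ≤
      ENNReal.ofReal ((1 / (1 - s) + 1 / s) * k ^ s) := by
  have hc : 0 < k⁻¹ := inv_pos.2 hk
  have e1 : ∫⁻ t in Ioc 0 k⁻¹, ENNReal.ofReal (k * t ^ (-s)) =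
      ENNReal.ofReal (1 / (1 - s) * k ^ s) := by
    rw [← ofReal_integral_eq_lintegral_ofReal]
    · rw [integral_const_mul, ← intervalIntegral.integral_of_le hc.le,
        integral_rpow (Or.inl (by linarith)), Real.zero_rpow (by linarith),
        Real.inv_rpow hk.le, ← Real.rpow_neg hk.le, show -(-s + 1) = s - 1 by ring,
        Real.rpow_sub_one hk.ne']
      congr 1
      have : 1 - s ≠ 0 := by linarith
      have : -s + 1 ≠ 0 := by linarith
      rw [show -s + 1 = 1 - s by ring]
      field_simp
      ring
    · exact ((intervalIntegrable_iff_integrableOn_Ioc_of_le hc.le).1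
        (intervalIntegral.intervalIntegrable_rpow' (by linarith))).const_mul k
    · exact (ae_restrict_mem measurableSet_Ioc).mono fun t ht =>
        mul_nonneg hk.le (Real.rpow_nonneg ht.1.le _)
  have e2 : ∫⁻ t in Ioi k⁻¹, ENNReal.ofReal (t ^ (-(s + 1))) = ENNReal.ofReal (1 / s * k ^ s) := by
    rw [← ofReal_integral_eq_lintegral_ofReal]
    · rw [integral_Ioi_rpow_of_lt (by linarith) hc, show -(s + 1) + 1 = -s by ring,
        Real.inv_rpow hk.le, ← Real.rpow_neg hk.le, neg_neg]
      congr 1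
      field_simp
    · exact integrableOn_Ioi_rpow_of_lt (by linarith) hc
    · exact (ae_restrict_mem measurableSet_Ioi).mono fun t ht =>
        Real.rpow_nonneg (hc.trans ht).le _
  have h1s : 0 < 1 - s := by linarith
  rw [← Ioc_union_Ioi_eq_Ioi hc.le, add_mul, ENNReal.ofReal_add (by positivity) (by positivity),
    ← e1, ← e2]
  refine (lintegral_union_le _ _ _).trans (add_le_add ?_ ?_)
  · exact lintegral_mono fun t => ENNReal.ofReal_le_ofReal (min_le_right _ _)
  · exact lintegral_mono fun t => ENNReal.ofReal_le_ofReal (min_le_left _ _)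

theorem measurable_min_rpow (s k : ℝ) :
    Measurable fun t : ℝ => ENNReal.ofReal (min (t ^ (-(s + 1))) (k * t ^ (-s))) :=
  ((measurable_id.pow_const _).min ((measurable_id.pow_const _).const_mul k)).ennreal_ofReal

theorem abs_le_pi_mul_norm_sub {θ : ℝ} (hθ : |θ| ≤ π) {ρ : ℝ} (h0 : 0 ≤ ρ) (h1 : ρ < 1) :
    |θ| ≤ π * ‖circleMap 0 1 θ - ρ‖ := by
  have a1 : 2 / π * |θ| ≤ ‖circleMap 0 1 θ - 1‖ := by
    have e : circleMap 0 1 θ - 1 = cexp (I * θ) - 1 := by simp [circleMap, mul_comm]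
    rw [e, Complex.norm_exp_I_mul_ofReal_sub_one, norm_mul, Real.norm_eq_abs, Real.norm_eq_abs]
    have := Real.mul_abs_le_abs_sin (x := θ / 2) (by rw [abs_div, abs_two]; linarith)
    rw [abs_div, abs_two] at this
    rw [abs_two]
    linarith
  have a2 : 1 - ρ ≤ ‖circleMap 0 1 θ - ρ‖ := by
    have := one_sub_norm_le (ρ : ℂ) θ
    rwa [norm_real, Real.norm_of_nonneg h0] at this
  have a3 : ‖circleMap 0 1 θ - 1‖ ≤ ‖circleMap 0 1 θ - ρ‖ + (1 - ρ) := by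
    have : circleMap 0 1 θ - 1 = (circleMap 0 1 θ - ρ) + ((ρ - 1 : ℝ) : ℂ) := by push_cast; ring
    rw [this]
    refine (norm_add_le _ _).trans ?_
    rw [norm_real, Real.norm_eq_abs, abs_of_nonpos (by linarith)]
    linarith
  have a4 : 2 / π * |θ| ≤ 2 * ‖circleMap 0 1 θ - ρ‖ := by linarith
  rw [div_mul_eq_mul_div, div_le_iff₀ Real.pi_pos] at a4
  linarith

/-- A bound for products of decreasing powers of `‖e^{iθ} - ρ‖`. -/
theorem rpow_neg_norm_sub_le {θ : ℝ} (hθ : |θ| ≤ π) (hθ0 : θ ≠ 0) {ρ : ℝ} (h0 : 0 ≤ ρ)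
    (h1 : ρ < 1) {s : ℝ} (hs0 : 0 ≤ s) (hs : s ≤ 2) :
    ‖circleMap 0 1 θ - ρ‖ ^ (-s) ≤ 16 * |θ| ^ (-s) := by
  have hp : 0 < |θ| := abs_pos.2 hθ0
  have hx : |θ| / π ≤ ‖circleMap 0 1 θ - ρ‖ := by
    rw [div_le_iff₀ Real.pi_pos, mul_comm]
    exact abs_le_pi_mul_norm_sub hθ h0 h1
  calc ‖circleMap 0 1 θ - ρ‖ ^ (-s) ≤ (|θ| / π) ^ (-s) :=
        Real.rpow_le_rpow_of_nonpos (by positivity) hx (by linarith)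
    _ = π ^ s * |θ| ^ (-s) := by
        rw [Real.div_rpow hp.le Real.pi_pos.le, Real.rpow_neg Real.pi_pos.le]
        field_simp
    _ ≤ 16 * |θ| ^ (-s) := by
        gcongr
        calc π ^ s ≤ π ^ (2:ℝ) := Real.rpow_le_rpow_of_exponent_le (by linarith [Real.pi_gt_three]) hs
          _ ≤ 4 ^ (2:ℝ) := by gcongr; exact Real.pi_le_four
          _ = 16 := by norm_num

theorem exists_eq_norm_mul_circleMap (z : ℂ) : ∃ φ : ℝ, z = ‖z‖ * circleMap 0 1 φ :=
  ⟨arg z, by simp [circleMap, Complex.norm_mul_exp_arg_mul_I]⟩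

theorem lintegral_circProb_le (u : ℝ → ℝ≥0∞) :
    ∫⁻ θ, u θ ∂circProb ≤ ∫⁻ θ in Ioc (-π) π, u θ := by
  rw [circProb, lintegral_smul_measure, smul_eq_mul]
  refine mul_le_of_le_one_left' ?_
  rw [ENNReal.ofReal_le_one]
  exact inv_le_one_of_one_le₀ (by linarith [Real.pi_gt_three])

theorem exists_lintegral_norm_sub_rpow_le : ∃ C : ℝ, 0 < C ∧ ∀ z : ℂ, ‖z‖ < 1 →
    ∫⁻ θ, ENNReal.ofReal (‖circleMap 0 1 θ - z‖ ^ (-(3/2) : ℝ)) ∂circProb ≤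
      ENNReal.ofReal (C * (1 - ‖z‖) ^ (-(1/2) : ℝ)) := by
  refine ⟨16 * 2 * (1 / (1 - 1/2) + 1 / (1/2)), by norm_num, fun z hz => ?_⟩
  obtain ⟨φ, hφ⟩ := exists_eq_norm_mul_circleMap z
  set ρ := ‖z‖ with hρ
  have hρ0 : 0 ≤ ρ := norm_nonneg z
  have ht : 0 < 1 - ρ := by linarith
  have h1 := lintegral_circProb_rotate
    (fun ζ => ENNReal.ofReal (‖ζ - z‖ ^ (-(3/2) : ℝ))) φ
  have h2 : ∀ θ, ‖circleMap 0 1 θ * circleMap 0 1 φ - z‖ = ‖circleMap 0 1 θ - ρ‖ := fun θ => by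
    rw [hφ, ← sub_mul, norm_mul, norm_circleMap_one, mul_one]
  simp only [h2] at h1
  rw [← h1]
  refine (lintegral_circProb_le _).trans ?_
  have h3 : ∀ᵐ θ ∂(volume.restrict (Ioc (-π) π)),
      ENNReal.ofReal (‖circleMap 0 1 θ - ρ‖ ^ (-(3/2) : ℝ)) ≤ ENNReal.ofReal 16 *
      ENNReal.ofReal (min (|θ| ^ (-((1/2 : ℝ) + 1))) ((1 - ρ)⁻¹ * |θ| ^ (-(1/2) : ℝ))) := by
    have h0 : ∀ᵐ θ ∂(volume.restrict (Ioc (-π) π)), θ ≠ 0 :=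
      ae_restrict_of_ae (Measure.ae_ne volume 0)
    filter_upwards [ae_restrict_mem measurableSet_Ioc, h0] with θ hθ hθ0
    have hθ' : |θ| ≤ π := abs_le.2 ⟨hθ.1.le, hθ.2⟩
    rw [← ENNReal.ofReal_mul (by norm_num)]
    apply ENNReal.ofReal_le_ofReal
    rw [mul_min_of_nonneg _ _ (by norm_num)]
    refine le_min ?_ ?_
    · rw [show -((1/2 : ℝ) + 1) = -(3/2) by norm_num]
      exact rpow_neg_norm_sub_le hθ' hθ0 hρ0 hz (by norm_num) (by norm_num)
    · have hx : 1 - ρ ≤ ‖circleMap 0 1 θ - ρ‖ := by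
        have := one_sub_norm_le (ρ : ℂ) θ
        rwa [norm_real, Real.norm_of_nonneg hρ0] at this
      have hx0 : 0 < ‖circleMap 0 1 θ - ρ‖ := ht.trans_le hx
      rw [show (-(3/2) : ℝ) = -1 + -(1/2) by norm_num, Real.rpow_add hx0, Real.rpow_neg_one,
        mul_left_comm]
      gcongr
      exact rpow_neg_norm_sub_le hθ' hθ0 hρ0 hz (by norm_num) (by norm_num)
  refine (lintegral_mono_ae h3).trans ?_
  rw [lintegral_const_mul' _ _ ENNReal.ofReal_ne_top]
  have h4 := lintegral_comp_abs_le _ (measurable_min_rpow (1/2) (1 - ρ)⁻¹)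
  have h5 := lintegral_min_rpow_le (s := 1/2) (by norm_num) (by norm_num) (inv_pos.2 ht)
  calc _ ≤ ENNReal.ofReal 16 * (2 * ENNReal.ofReal ((1 / (1 - 1/2) + 1 / (1/2)) *
          (1 - ρ)⁻¹ ^ (1/2 : ℝ))) := by
        gcongr
        exact (setLIntegral_le_lintegral _ _).trans (h4.trans (by gcongr))
    _ = _ := by
        rw [show (2 : ℝ≥0∞) = ENNReal.ofReal 2 by simp, ← ENNReal.ofReal_mul (by norm_num),
          ← ENNReal.ofReal_mul (by norm_num), Real.inv_rpow ht.le, ← Real.rpow_neg ht.le]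
        congr 1
        ring

end KernelIntegrals

end BoundaryFlat

namespace BoundaryFlat

open scoped Real Topology

/-- `u z = o((1 - ‖z‖) ^ (α - 1))` as `‖z‖ → 1`, for a function that is bounded on compact
subsets of the disc. -/
def SmallGrowth (α : ℝ) (u : ℂ → ℝ) : Prop :=
  ∀ ε > 0, ∃ K ≥ 0, ∀ z : ℂ, ‖z‖ < 1 → u z ≤ ε * (1 - ‖z‖) ^ (α - 1) + K

section Growth

variable {α : ℝ} {f : ℂ → ℂ}

theorem SmallGrowth.mono {u v : ℂ → ℝ} (hu : SmallGrowth α u)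
    (h : ∀ z : ℂ, ‖z‖ < 1 → v z ≤ u z) : SmallGrowth α v := fun ε hε => by
  obtain ⟨K, hK, hu⟩ := hu ε hε
  exact ⟨K, hK, fun z hz => (h z hz).trans (hu z hz)⟩

theorem SmallGrowth.add {u v : ℂ → ℝ} (hu : SmallGrowth α u) (hv : SmallGrowth α v) :
    SmallGrowth α (fun z => u z + v z) := fun ε hε => by
  obtain ⟨K, hK, hu⟩ := hu (ε / 2) (by positivity)
  obtain ⟨L, hL, hv⟩ := hv (ε / 2) (by positivity)
  refine ⟨K + L, by positivity, fun z hz => ?_⟩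
  have h1 := hu z hz
  have h2 := hv z hz
  dsimp only
  linarith

theorem SmallGrowth.const_mul {u : ℂ → ℝ} (hu : SmallGrowth α u) {c : ℝ} (hc : 0 ≤ c) :
    SmallGrowth α (fun z => c * u z) := fun ε hε => by
  obtain ⟨K, hK, hu⟩ := hu (ε / (c + 1)) (by positivity)
  refine ⟨c * K, by positivity, fun z hz => ?_⟩
  have h1 : 0 ≤ (1 - ‖z‖) ^ (α - 1) := Real.rpow_nonneg (by linarith) _
  calc c * u z ≤ c * (ε / (c + 1) * (1 - ‖z‖) ^ (α - 1) + K) := by gcongr; exact hu z hz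
    _ = c / (c + 1) * (ε * (1 - ‖z‖) ^ (α - 1)) + c * K := by ring
    _ ≤ 1 * (ε * (1 - ‖z‖) ^ (α - 1)) + c * K := by
        gcongr
        rw [div_le_one (by positivity)]
        linarith
    _ = _ := by ring

theorem exists_norm_bound (hf : ContinuousOn f (closedBall 0 1)) :
    ∃ S ≥ 0, ∀ z ∈ closedBall (0:ℂ) 1, ‖f z‖ ≤ S := by
  obtain ⟨S, hS⟩ := (isCompact_closedBall (0:ℂ) 1).exists_bound_of_continuousOn hf
  exact ⟨S, (norm_nonneg _).trans (hS 0 (by simp)), hS⟩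

theorem exists_norm_sub_le (hf : ContinuousOn f (closedBall 0 1)) (hL : LittleLip α f)
    {ε : ℝ} (hε : 0 < ε) : ∃ K ≥ 0, ∀ z ∈ closedBall (0:ℂ) 1, ∀ w ∈ closedBall (0:ℂ) 1,
      ‖f z - f w‖ ≤ ε * ‖z - w‖ ^ α + K * ‖z - w‖ ^ 2 := by
  obtain ⟨S, hS0, hS⟩ := exists_norm_bound hf
  obtain ⟨δ, hδ, hL⟩ := hL ε hε
  refine ⟨2 * S / δ ^ 2, by positivity, fun z hz w hw => ?_⟩
  have h0 : 0 ≤ ε * ‖z - w‖ ^ α := by positivity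
  rcases lt_or_ge ‖z - w‖ δ with h | h
  · have := hL z hz w hw h
    have h2 : 0 ≤ 2 * S / δ ^ 2 * ‖z - w‖ ^ 2 := by positivity
    linarith
  · have h1 : ‖f z - f w‖ ≤ 2 * S := (norm_sub_le _ _).trans (by linarith [hS z hz, hS w hw])
    have h2 : 2 * S ≤ 2 * S / δ ^ 2 * ‖z - w‖ ^ 2 := by
      rw [div_mul_eq_mul_div, le_div_iff₀ (by positivity)]
      gcongr
    linarith

theorem exists_hoelder (hα0 : 0 < α) (hα1 : α ≤ 1/2) (hf : ContinuousOn f (closedBall 0 1))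
    (hL : LittleLip α f) : ∃ K > 0, ∀ z ∈ closedBall (0:ℂ) 1, ∀ w ∈ closedBall (0:ℂ) 1,
      ‖f z - f w‖ ≤ K * ‖z - w‖ ^ α := by
  obtain ⟨K, hK, h⟩ := exists_norm_sub_le hf hL one_pos
  refine ⟨1 + K * 4, by positivity, fun z hz w hw => (h z hz w hw).trans ?_⟩
  rw [add_mul, mul_assoc]
  gcongr
  have h2 : ‖z - w‖ ≤ 2 := (norm_sub_le _ _).trans (by
    linarith [mem_closedBall_zero_iff.1 hz, mem_closedBall_zero_iff.1 hw])
  rcases (norm_nonneg (z - w)).eq_or_lt with h0 | h0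
  · rw [← h0]; simp [Real.zero_rpow hα0.ne']
  calc ‖z - w‖ ^ 2 = ‖z - w‖ ^ (2 - α) * ‖z - w‖ ^ α := by
        rw [← Real.rpow_add h0, sub_add_cancel, Real.rpow_two]
    _ ≤ 4 * ‖z - w‖ ^ α := by
        gcongr
        calc ‖z - w‖ ^ (2 - α) ≤ 2 ^ (2 - α) :=
              Real.rpow_le_rpow h0.le h2 (by linarith)
          _ ≤ 2 ^ (2:ℝ) := Real.rpow_le_rpow_of_exponent_le (by norm_num) (by linarith)
          _ = 4 := by norm_num

theorem smallGrowth_deriv (hα0 : 0 < α) (hfd : DifferentiableOn ℂ f (ball 0 1))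
    (hf : ContinuousOn f (closedBall 0 1)) (hL : LittleLip α f) :
    SmallGrowth α (fun z => ‖deriv f z‖) := fun ε hε => by
  obtain ⟨K, hK, h⟩ := exists_norm_sub_le hf hL (half_pos hε)
  refine ⟨K, hK, fun z hz => ?_⟩
  set t := 1 - ‖z‖ with ht
  have ht0 : 0 < t := by rw [ht]; linarith
  have ht1 : t ≤ 1 := by linarith [norm_nonneg z]
  have hsub : closedBall z (t / 2) ⊆ ball 0 1 := fun w hw => by
    rw [mem_closedBall_iff_norm] at hw
    rw [mem_ball_zero_iff]
    have := norm_le_norm_add_norm_sub' w z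
    linarith
  have hd : DiffContOnCl ℂ (fun w => f w - f z) (ball z (t / 2)) := by
    refine (DifferentiableOn.diffContOnCl ?_).sub_const _
    rw [closure_ball z (by positivity)]
    exact hfd.mono hsub
  have hz1 : z ∈ closedBall (0:ℂ) 1 := by simpa using hz.le
  have hC : ∀ w ∈ sphere z (t / 2), ‖f w - f z‖ ≤ ε / 2 * (t / 2) ^ α + K * (t / 2) ^ 2 :=
    fun w hw => by
      have := h w (ball_subset_closedBall (hsub (sphere_subset_closedBall hw))) z hz1
      rwa [mem_sphere_iff_norm.1 hw] at this
  have h1 := Complex.norm_deriv_le_of_forall_mem_sphere_norm_le (by positivity) hd hC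
  rw [deriv_sub_const] at h1
  refine h1.trans ?_
  have h2 : (ε / 2 * (t / 2) ^ α + K * (t / 2) ^ 2) / (t / 2) =
      ε * t ^ (α - 1) * (2⁻¹ ^ α) + K * (t / 2) := by
    rw [div_eq_mul_inv t 2, Real.mul_rpow ht0.le (by norm_num), Real.rpow_sub_one ht0.ne']
    field_simp
  rw [h2]
  have h3 : (2⁻¹ : ℝ) ^ α ≤ 1 := Real.rpow_le_one (by norm_num) (by norm_num) hα0.le
  have h4 : 0 ≤ ε * t ^ (α - 1) := by positivity
  nlinarith

theorem continuous_norm_sub_rpow {z : ℂ} (hz : ‖z‖ < 1) (s : ℝ) :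
    Continuous fun θ => ‖circleMap 0 1 θ - z‖ ^ s :=
  ((continuous_circleMap 0 1).sub continuous_const).norm.rpow_const
    fun θ => Or.inl (circleMap_sub_pos hz θ).ne'

theorem exists_integral_norm_sub_rpow_le : ∃ C : ℝ, 0 < C ∧ ∀ z : ℂ, ‖z‖ < 1 →
    ∫ θ, ‖circleMap 0 1 θ - z‖ ^ (-(3/2) : ℝ) ∂circProb ≤ C * (1 - ‖z‖) ^ (-(1/2) : ℝ) := by
  obtain ⟨C, hC, h⟩ := exists_lintegral_norm_sub_rpow_le
  refine ⟨C, hC, fun z hz => ?_⟩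
  have h1 : 0 ≤ C * (1 - ‖z‖) ^ (-(1/2) : ℝ) :=
    mul_nonneg hC.le (Real.rpow_nonneg (by linarith) _)
  rw [integral_eq_lintegral_of_nonneg_ae (ae_of_all _ fun θ => by positivity)
    (continuous_norm_sub_rpow hz _).aestronglyMeasurable]
  exact ENNReal.toReal_le_of_le_ofReal h1 (h z hz)

theorem osc_div_eq {z : ℂ} (hz : ‖z‖ < 1) : osc f z / (1 - ‖z‖ ^ 2) =
    ∫ θ, ‖f (circleMap 0 1 θ) - f z‖ / ‖circleMap 0 1 θ - z‖ ^ 2 ∂circProb := by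
  rw [osc, ← integral_div]
  congr 1 with θ
  have := (one_sub_sq_pos hz).ne'
  rw [pk]
  field_simp

theorem smallGrowth_osc (hα1 : α ≤ 1/2) (hf : ContinuousOn f (closedBall 0 1))
    (hc : Continuous fun θ => f (circleMap 0 1 θ)) (hL : LittleLip α f) :
    SmallGrowth α (fun z => osc f z / (1 - ‖z‖ ^ 2)) := fun ε hε => by
  obtain ⟨C, hC, hCz⟩ := exists_integral_norm_sub_rpow_le
  obtain ⟨K, hK, h⟩ := exists_norm_sub_le hf hL (div_pos hε hC)
  refine ⟨K, hK, fun z hz => ?_⟩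
  have hz1 : z ∈ closedBall (0:ℂ) 1 := by simpa using hz.le
  have ht0 : 0 < 1 - ‖z‖ := by linarith
  dsimp only
  rw [osc_div_eq hz]
  have hi := integrable_circProb_of_continuous (continuous_norm_sub_rpow hz (-(3/2)))
  calc _ ≤ ∫ θ, (ε / C * (1 - ‖z‖) ^ (α - 1/2) * ‖circleMap 0 1 θ - z‖ ^ (-(3/2) : ℝ) + K)
        ∂circProb := by
        refine integral_mono (integrable_circProb_of_continuous ?_)
          ((hi.const_mul _).add (integrable_const _)) fun θ => ?_
        · exact (hc.sub continuous_const).norm.div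
            (((continuous_circleMap 0 1).sub continuous_const).norm.pow 2)
            fun θ => (pow_pos (circleMap_sub_pos hz θ) 2).ne'
        · have hx := circleMap_sub_pos hz θ
          have hx1 := one_sub_norm_le z θ
          dsimp only
          rw [div_le_iff₀ (by positivity), add_mul]
          refine (h _ (circleMap_mem_closedBall θ) z hz1).trans ?_
          gcongr ?_ + _
          have e : ‖circleMap 0 1 θ - z‖ ^ α = ‖circleMap 0 1 θ - z‖ ^ (α - 1/2) *
              ‖circleMap 0 1 θ - z‖ ^ (-(3/2) : ℝ) * ‖circleMap 0 1 θ - z‖ ^ 2 := by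
            rw [← Real.rpow_two, ← Real.rpow_add hx, ← Real.rpow_add hx]
            congr 1; ring
          rw [e]
          have : ‖circleMap 0 1 θ - z‖ ^ (α - 1/2) ≤ (1 - ‖z‖) ^ (α - 1/2) :=
            Real.rpow_le_rpow_of_nonpos ht0 hx1 (by linarith)
          calc _ ≤ ε / C * ((1 - ‖z‖) ^ (α - 1/2) * ‖circleMap 0 1 θ - z‖ ^ (-(3/2) : ℝ) *
                ‖circleMap 0 1 θ - z‖ ^ 2) := by gcongr
            _ = _ := by ring
    _ = ε / C * (1 - ‖z‖) ^ (α - 1/2) * ∫ θ, ‖circleMap 0 1 θ - z‖ ^ (-(3/2) : ℝ) ∂circProb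
        + K := by
        rw [integral_add (hi.const_mul _) (integrable_const _), integral_const_mul]
        simp
    _ ≤ ε / C * (1 - ‖z‖) ^ (α - 1/2) * (C * (1 - ‖z‖) ^ (-(1/2) : ℝ)) + K := by
        gcongr
        exact hCz z hz
    _ = _ := by
        have e : (1 - ‖z‖) ^ (α - 1) = (1 - ‖z‖) ^ (α - 1/2) * (1 - ‖z‖) ^ (-(1/2) : ℝ) := by
          rw [← Real.rpow_add ht0]
          congr 1; ring
        rw [e]
        field_simp

end Growth

end BoundaryFlat

namespace BoundaryFlat

open scoped Real Topology

section HardyLittlewood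

variable {α : ℝ} {F : ℂ → ℂ}

theorem norm_sub_smul_le (hα0 : 0 < α) (hα1 : α < 1) (hF : DifferentiableOn ℂ F (ball 0 1))
    {ε K : ℝ} (hε : 0 ≤ ε)
    (hb : ∀ z : ℂ, ‖z‖ < 1 → ‖deriv F z‖ ≤ ε * (1 - ‖z‖) ^ (α - 1) + K)
    {z : ℂ} (hz : ‖z‖ < 1) {s : ℝ} (hs0 : 0 ≤ s) (hs1 : s ≤ 1) :
    ‖F z - F (((1 - s : ℝ) : ℂ) * z)‖ ≤ ε / α * s ^ α + K * s := by
  set γ : ℝ → ℂ := fun y => F (((1 - s + y : ℝ) : ℂ) * z) with hγ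
  have hnorm : ∀ y ∈ Icc 0 s, ‖((1 - s + y : ℝ) : ℂ) * z‖ = (1 - s + y) * ‖z‖ := fun y hy => by
    rw [norm_mul, norm_real, Real.norm_of_nonneg (by linarith [hy.1])]
  have hlt : ∀ y ∈ Icc 0 s, ‖((1 - s + y : ℝ) : ℂ) * z‖ < 1 := fun y hy => by
    rw [hnorm y hy]
    have : (1 - s + y) ≤ 1 := by linarith [hy.2]
    nlinarith [norm_nonneg z]
  have hder : ∀ y ∈ Icc 0 s, HasDerivAt γ
      (deriv F (((1 - s + y : ℝ) : ℂ) * z) * z) y := fun y hy => by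
    have h1 : HasDerivAt F (deriv F (((1 - s + y : ℝ) : ℂ) * z)) (((1 - s + y : ℝ) : ℂ) * z) :=
      (hF.differentiableAt (isOpen_ball.mem_nhds (by simpa using hlt y hy))).hasDerivAt
    have h2 : HasDerivAt (fun y : ℝ => ((1 - s + y : ℝ) : ℂ) * z) (1 * z) y := by
      refine HasDerivAt.mul_const ?_ z
      exact ((hasDerivAt_id y).const_add (1 - s)).ofReal_comp
    rw [one_mul] at h2
    exact h1.comp y h2
  have key := image_norm_le_of_norm_deriv_right_le_deriv_boundary'
    (f := fun y => γ y - γ 0) (f' := fun y => deriv F (((1 - s + y : ℝ) : ℂ) * z) * z)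
    (a := 0) (b := s) (B := fun y => ε / α * (s ^ α - (s - y) ^ α) + K * y)
    (B' := fun y => ε * (s - y) ^ (α - 1) + K)
    (fun y hy => ((hder y hy).continuousAt.sub continuousAt_const).continuousWithinAt)
    (fun y hy => ((hder y (Ico_subset_Icc_self hy)).sub_const _).hasDerivWithinAt)
    (by simp)
    (by
      refine Continuous.continuousOn ?_
      have : Continuous fun y : ℝ => (s - y) ^ α :=
        (continuous_const.sub continuous_id).rpow_const fun _ => Or.inr hα0.le
      fun_prop)
    (fun y hy => by
      have h0 : s - y ≠ 0 := by linarith [hy.2]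
      have h1 : HasDerivAt (fun y : ℝ => (s - y) ^ α) (-1 * α * (s - y) ^ (α - 1)) y :=
        ((hasDerivAt_id y).const_sub s).rpow_const (Or.inl h0)
      have h2 := ((h1.const_sub (s ^ α)).const_mul (ε / α)).add ((hasDerivAt_id y).const_mul K)
      refine (h2.congr_deriv ?_).hasDerivWithinAt
      field_simp)
    (fun y hy => by
      have hy' := Ico_subset_Icc_self hy
      have h1 := hb _ (hlt y hy')
      have h3 : 0 < s - y := by linarith [hy.2]
      have h2 : s - y ≤ 1 - ‖((1 - s + y : ℝ) : ℂ) * z‖ := by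
        rw [hnorm y hy']
        have : 0 ≤ 1 - s + y := by linarith [hy.1]
        nlinarith [norm_nonneg z]
      rw [norm_mul]
      calc _ ≤ ‖deriv F (((1 - s + y : ℝ) : ℂ) * z)‖ * 1 := by gcongr
        _ ≤ ε * (1 - ‖((1 - s + y : ℝ) : ℂ) * z‖) ^ (α - 1) + K := by rw [mul_one]; exact h1
        _ ≤ _ := by
          gcongr ε * ?_ + K
          exact Real.rpow_le_rpow_of_nonpos h3 h2 (by linarith))
    (x := s) ⟨hs0, le_rfl⟩
  simpa [hγ, Real.zero_rpow hα0.ne'] using key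

theorem norm_sub_le_of_deriv_le (hα0 : 0 < α) (hα1 : α < 1)
    (hF : DifferentiableOn ℂ F (ball 0 1)) {ε K : ℝ} (hε : 0 ≤ ε) (hK : 0 ≤ K)
    (hb : ∀ z : ℂ, ‖z‖ < 1 → ‖deriv F z‖ ≤ ε * (1 - ‖z‖) ^ (α - 1) + K)
    {z w : ℂ} (hz : ‖z‖ < 1) (hw : ‖w‖ < 1) (hs1 : ‖z - w‖ ≤ 1) :
    ‖F z - F w‖ ≤ ε * (2 / α + 1) * ‖z - w‖ ^ α + 3 * K * ‖z - w‖ := by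
  set s := ‖z - w‖ with hs
  rcases (norm_nonneg (z - w)).eq_or_lt with h0 | h0
  · rw [sub_eq_zero.1 (norm_eq_zero.1 h0.symm), sub_self, norm_zero]
    positivity
  rw [← hs] at h0
  have h1 := norm_sub_smul_le hα0 hα1 hF hε hb hz h0.le hs1
  have h2 := norm_sub_smul_le hα0 hα1 hF hε hb hw h0.le hs1
  have hmem : ∀ v : ℂ, ‖v‖ < 1 → ((1 - s : ℝ) : ℂ) * v ∈ closedBall (0:ℂ) (1 - s) := fun v hv => by
    rw [mem_closedBall_zero_iff, norm_mul, norm_real, Real.norm_of_nonneg (by linarith)]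
    exact mul_le_of_le_one_right (by linarith) hv.le
  have h3 : ‖F (((1 - s : ℝ) : ℂ) * z) - F (((1 - s : ℝ) : ℂ) * w)‖ ≤
      (ε * s ^ (α - 1) + K) * ‖((1 - s : ℝ) : ℂ) * z - ((1 - s : ℝ) : ℂ) * w‖ := by
    refine (convex_closedBall (0:ℂ) (1 - s)).norm_image_sub_le_of_norm_deriv_le (fun u hu => ?_)
      (fun u hu => ?_) (hmem w hw) (hmem z hz)
    · rw [mem_closedBall_zero_iff] at hu
      exact hF.differentiableAt (isOpen_ball.mem_nhds (by rw [mem_ball_zero_iff]; linarith))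
    · rw [mem_closedBall_zero_iff] at hu
      refine (hb u (by linarith)).trans ?_
      gcongr ε * ?_ + K
      exact Real.rpow_le_rpow_of_nonpos h0 (by linarith) (by linarith)
  rw [← mul_sub, norm_mul, norm_real, Real.norm_of_nonneg (by linarith), ← hs] at h3
  have h4 : (ε * s ^ (α - 1) + K) * ((1 - s) * s) ≤ (ε * s ^ (α - 1) + K) * s := by
    have : 0 ≤ ε * s ^ (α - 1) + K := by positivity
    gcongr
    nlinarith
  have h5 : (ε * s ^ (α - 1) + K) * s = ε * s ^ α + K * s := by
    rw [Real.rpow_sub_one h0.ne']; field_simp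
  have h6 : F z - F w = (F z - F (((1 - s : ℝ) : ℂ) * z)) +
      (F (((1 - s : ℝ) : ℂ) * z) - F (((1 - s : ℝ) : ℂ) * w)) -
      (F w - F (((1 - s : ℝ) : ℂ) * w)) := by ring
  rw [h6]
  refine (norm_sub_le _ _).trans ((add_le_add_left (norm_add_le _ _) _).trans ?_)
  have : ε * (2 / α + 1) * s ^ α + 3 * K * s =
    (ε / α * s ^ α + K * s) + (ε * s ^ α + K * s) + (ε / α * s ^ α + K * s) := by ring
  rw [this]
  gcongr
  exact h3.trans (h4.trans h5.le)

theorem SmallGrowth.exists_norm_sub_le (hα0 : 0 < α) (hα1 : α ≤ 1/2)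
    (hF : DifferentiableOn ℂ F (ball 0 1)) (hb : SmallGrowth α (fun z => ‖deriv F z‖)) :
    ∀ ε > 0, ∃ δ > 0, ∀ z : ℂ, ‖z‖ < 1 → ∀ w : ℂ, ‖w‖ < 1 →
      ‖z - w‖ < δ → ‖F z - F w‖ ≤ ε * ‖z - w‖ ^ α := fun ε hε => by
  obtain ⟨K, hK, hb⟩ := hb (ε / 2 / (2 / α + 1)) (by positivity)
  refine ⟨min 1 ((ε / (6 * K + 1)) ^ 2), by positivity, fun z hz w hw hzw => ?_⟩
  have h1 := norm_sub_le_of_deriv_le hα0 (by linarith) hF (by positivity) hK hb hz hw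
    (hzw.le.trans (min_le_left _ _))
  refine h1.trans ?_
  rw [div_mul_cancel₀ _ (by positivity)]
  set s := ‖z - w‖ with hs
  have hs0 : 0 ≤ s := norm_nonneg _
  have hs1 : s ≤ 1 := hzw.le.trans (min_le_left _ _)
  have h2 : √s ≤ ε / (6 * K + 1) := by
    rw [Real.sqrt_le_left (by positivity)]
    exact hzw.le.trans (min_le_right _ _)
  rcases hs0.eq_or_lt with h0 | h0
  · rw [← h0]; simp [Real.zero_rpow hα0.ne']
  have h3 : s ≤ s ^ α * √s := by
    rw [Real.sqrt_eq_rpow, ← Real.rpow_add h0]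
    calc s = s ^ (1:ℝ) := (Real.rpow_one s).symm
      _ ≤ _ := Real.rpow_le_rpow_of_exponent_ge h0 hs1 (by linarith)
  have h4 : 3 * K * s ≤ ε / 2 * s ^ α := by
    calc 3 * K * s ≤ 3 * K * (s ^ α * (ε / (6 * K + 1))) := by
          gcongr
          exact h3.trans (by gcongr)
      _ = (6 * K / (6 * K + 1)) * (ε / 2 * s ^ α) := by field_simp; ring
      _ ≤ 1 * (ε / 2 * s ^ α) := by
          gcongr
          rw [div_le_one (by positivity)]
          linarith
      _ = _ := one_mul _
  linarith

theorem SmallGrowth.littleLip (hα0 : 0 < α) (hα1 : α ≤ 1/2)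
    (hF : DifferentiableOn ℂ F (ball 0 1)) (hFc : ContinuousOn F (closedBall 0 1))
    (hb : SmallGrowth α (fun z => ‖deriv F z‖)) : LittleLip α F := fun ε hε => by
  obtain ⟨δ, hδ, h⟩ := hb.exists_norm_sub_le hα0 hα1 hF ε hε
  refine ⟨δ, hδ, fun z hz w hw hzw => ?_⟩
  have hmem : ∀ v ∈ closedBall (0:ℂ) 1, ∀ r ∈ Ico (0:ℝ) 1, ‖(r:ℂ) * v‖ < 1 := fun v hv r hr => by
    rw [norm_mul, norm_real, Real.norm_of_nonneg hr.1]
    rw [mem_closedBall_zero_iff] at hv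
    nlinarith [norm_nonneg v, hr.1, hr.2]
  have hlim : ∀ v ∈ closedBall (0:ℂ) 1, Tendsto (fun r : ℝ => F (r * v)) (𝓝[<] 1) (𝓝 (F v)) :=
    fun v hv => by
      refine (hFc v hv).tendsto.comp (tendsto_nhdsWithin_iff.2 ⟨?_, ?_⟩)
      · have : Tendsto (fun r : ℝ => (r:ℂ) * v) (𝓝 1) (𝓝 (((1:ℝ):ℂ) * v)) :=
          ((Complex.continuous_ofReal.mul continuous_const).tendsto 1)
        rw [ofReal_one, one_mul] at this
        exact this.mono_left nhdsWithin_le_nhds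
      · filter_upwards [Ico_mem_nhdsLT (zero_lt_one (α := ℝ))] with r hr
        exact mem_closedBall_zero_iff.2 (hmem v hv r hr).le
  refine le_of_tendsto ((hlim z hz).sub (hlim w hw)).norm ?_
  filter_upwards [Ico_mem_nhdsLT (zero_lt_one (α := ℝ))] with r hr
  have h1 : ‖(r:ℂ) * z - r * w‖ ≤ ‖z - w‖ := by
    rw [← mul_sub, norm_mul, norm_real, Real.norm_of_nonneg hr.1]
    exact mul_le_of_le_one_left (norm_nonneg _) hr.2.le
  refine (h _ (hmem z hz r hr) _ (hmem w hw r hr) (h1.trans_lt hzw)).trans ?_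
  gcongr

theorem SmallGrowth.exists_tendsto (hα0 : 0 < α) (hα1 : α ≤ 1/2)
    (hF : DifferentiableOn ℂ F (ball 0 1)) (hb : SmallGrowth α (fun z => ‖deriv F z‖))
    {ξ : ℂ} (hξ : ξ ∈ closedBall (0:ℂ) 1) : ∃ y, Tendsto F (𝓝[ball 0 1] ξ) (𝓝 y) := by
  have hne : (𝓝[ball (0:ℂ) 1] ξ).NeBot := by
    rw [← mem_closure_iff_nhdsWithin_neBot, closure_ball 0 one_ne_zero]
    exact hξ
  refine cauchy_map_iff_exists_tendsto.1 ?_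
  obtain ⟨δ, hδ, h⟩ := hb.exists_norm_sub_le hα0 hα1 hF 1 one_pos
  have huc : UniformContinuousOn F (ball 0 1) := by
    rw [Metric.uniformContinuousOn_iff]
    intro ε hε
    have hpos : 0 < ε ^ α⁻¹ := Real.rpow_pos_of_pos hε _
    refine ⟨min δ (ε ^ α⁻¹), lt_min hδ hpos, fun z hz w hw hzw => ?_⟩
    rw [dist_eq_norm] at hzw ⊢
    refine (h z (by simpa using hz) w (by simpa using hw)
      (hzw.trans_le (min_le_left _ _))).trans_lt ?_
    rw [one_mul]
    calc ‖z - w‖ ^ α < (ε ^ α⁻¹) ^ α :=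
          Real.rpow_lt_rpow (norm_nonneg _) (hzw.trans_le (min_le_right _ _)) hα0
      _ = ε := Real.rpow_inv_rpow hε.le hα0.ne'
  exact (cauchy_nhds.mono nhdsWithin_le_nhds).map_of_le huc inf_le_right

end HardyLittlewood

end BoundaryFlat

namespace BoundaryFlat

open scoped Real Topology

/-- The outer function with boundary modulus `min 1 (c * ‖f‖) ^ N`. -/
noncomputable def flatOuter (f : ℂ → ℂ) (N c : ℝ) (z : ℂ) : ℂ := cexp (herglotz (cutLog f N c) z)

section Outer

variable {α N c : ℝ} {f : ℂ → ℂ} {z z₀ : ℂ}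

theorem continuous_boundary (hf : ContinuousOn f (closedBall 0 1)) :
    Continuous fun θ => f (circleMap 0 1 θ) :=
  hf.comp_continuous (continuous_circleMap 0 1) circleMap_mem_closedBall

theorem exists_boundary_bound (hf : ContinuousOn f (closedBall 0 1)) :
    ∃ S : ℝ, ∀ θ, ‖f (circleMap 0 1 θ)‖ ≤ S := by
  obtain ⟨S, -, hS⟩ := exists_norm_bound hf
  exact ⟨S, fun θ => hS _ (circleMap_mem_closedBall θ)⟩

theorem diffContOnCl_of_isDiscReg (hf : IsDiscReg f) : DiffContOnCl ℂ f (ball 0 1) :=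
  ⟨hf.1, by rw [closure_ball 0 one_ne_zero]; exact hf.2⟩

variable (hf : IsDiscReg f) (hN : 0 ≤ N) (hc1 : 1 ≤ c) (hz₀ : ‖z₀‖ < 1) (hfz₀ : f z₀ ≠ 0)

include hf hN hc1 hz₀ hfz₀

theorem integrable_cutLog' : Integrable (fun θ => cutLog f N c (circleMap 0 1 θ)) circProb :=
  integrable_cutLog (diffContOnCl_of_isDiscReg hf) (continuous_boundary hf.2)
    (exists_boundary_bound hf.2) hN hc1 hz₀ hfz₀

theorem hasDerivAt_flatOuter (hz : ‖z‖ < 1) : HasDerivAt (flatOuter f N c)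
    (flatOuter f N c z * deriv (herglotz (cutLog f N c)) z) z :=
  (hasDerivAt_herglotz (integrable_cutLog' hf hN hc1 hz₀ hfz₀)
    hz).differentiableAt.hasDerivAt.cexp

theorem norm_flatOuter (hz : ‖z‖ < 1) : ‖flatOuter f N c z‖ =
    Real.exp (∫ θ, pk z θ * cutLog f N c (circleMap 0 1 θ) ∂circProb) := by
  rw [flatOuter, Complex.norm_exp, re_herglotz (integrable_cutLog' hf hN hc1 hz₀ hfz₀) hz]

theorem norm_flatOuter_le_one (hz : ‖z‖ < 1) : ‖flatOuter f N c z‖ ≤ 1 := by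
  rw [norm_flatOuter hf hN hc1 hz₀ hfz₀ hz, Real.exp_le_one_iff]
  exact integral_nonpos fun θ =>
    mul_nonpos_of_nonneg_of_nonpos (pk_nonneg hz θ) (cutLog_nonpos hN _)

theorem norm_mul_deriv_flatOuter_le (hz : ‖z‖ < 1) :
    ‖f z * deriv (flatOuter f N c) z‖ ≤ 4 * N * (osc f z / (1 - ‖z‖ ^ 2)) := by
  rw [(hasDerivAt_flatOuter hf hN hc1 hz₀ hfz₀ hz).deriv, mul_left_comm, norm_mul]
  have h1 := norm_mul_deriv_herglotz_le (diffContOnCl_of_isDiscReg hf) (continuous_boundary hf.2)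
    (exists_boundary_bound hf.2) hN hc1 hz
  exact (mul_le_of_le_one_left (norm_nonneg _)
    (norm_flatOuter_le_one hf hN hc1 hz₀ hfz₀ hz)).trans h1

theorem norm_flatOuter_le_rpow (hz : ‖z‖ < 1) {a : ℝ} (ha : ‖f z‖ + osc f z ≤ a) (ha0 : 0 < a) :
    ‖flatOuter f N c z‖ ≤ (c * a) ^ N := by
  have hca : 0 < c * a := by positivity
  rw [norm_flatOuter hf hN hc1 hz₀ hfz₀ hz, Real.rpow_def_of_pos hca, mul_comm (Real.log _)]
  exact Real.exp_le_exp.2 (integral_pk_cutLog_le (diffContOnCl_of_isDiscReg hf)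
    (continuous_boundary hf.2) (exists_boundary_bound hf.2) hN hc1 hz hz₀ hfz₀ hca (by gcongr))

theorem hasDerivAt_mul_flatOuter (hz : ‖z‖ < 1) : HasDerivAt (fun z => f z * flatOuter f N c z)
    (deriv f z * flatOuter f N c z + f z * deriv (flatOuter f N c) z) z := by
  have h1 : HasDerivAt f (deriv f z) z :=
    (hf.1.differentiableAt (isOpen_ball.mem_nhds (by simpa using hz))).hasDerivAt
  exact h1.mul (hasDerivAt_flatOuter hf hN hc1 hz₀ hfz₀ hz).differentiableAt.hasDerivAt

theorem norm_deriv_mul_flatOuter_le (hz : ‖z‖ < 1) :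
    ‖deriv (fun z => f z * flatOuter f N c z) z‖ ≤
      ‖deriv f z‖ + 4 * N * (osc f z / (1 - ‖z‖ ^ 2)) := by
  rw [(hasDerivAt_mul_flatOuter hf hN hc1 hz₀ hfz₀ hz).deriv]
  refine (norm_add_le _ _).trans (add_le_add ?_
    (norm_mul_deriv_flatOuter_le hf hN hc1 hz₀ hfz₀ hz))
  rw [norm_mul]
  exact mul_le_of_le_one_right (norm_nonneg _) (norm_flatOuter_le_one hf hN hc1 hz₀ hfz₀ hz)

theorem differentiableOn_mul_flatOuter :
    DifferentiableOn ℂ (fun z => f z * flatOuter f N c z) (ball 0 1) := fun z hz =>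
  (hasDerivAt_mul_flatOuter hf hN hc1 hz₀ hfz₀
    (by simpa using hz)).differentiableAt.differentiableWithinAt

theorem smallGrowth_deriv_mul_flatOuter (hα0 : 0 < α) (hα1 : α ≤ 1/2) (hL : LittleLip α f) :
    SmallGrowth α (fun z => ‖deriv (fun z => f z * flatOuter f N c z) z‖) :=
  ((smallGrowth_deriv hα0 hf.1 hf.2 hL).add ((smallGrowth_osc hα1 hf.2
    (continuous_boundary hf.2) hL).const_mul (c := 4 * N) (by positivity))).mono fun _ hz =>
    norm_deriv_mul_flatOuter_le hf hN hc1 hz₀ hfz₀ hz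

omit hN hc1 hz₀ hfz₀ in
theorem tendsto_osc (hα0 : 0 < α) (hα1 : α ≤ 1/2) (hL : LittleLip α f) {ξ : ℂ} (hξ : ‖ξ‖ = 1) :
    Tendsto (osc f) (𝓝[ball 0 1] ξ) (𝓝 0) := by
  obtain ⟨K, hK, h⟩ := smallGrowth_osc hα1 hf.2 (continuous_boundary hf.2) hL 1 one_pos
  have hlim : Tendsto (fun z : ℂ => 2 * (1 - ‖z‖) ^ α + 2 * K * (1 - ‖z‖)) (𝓝 ξ) (𝓝 0) := by
    have hc : Continuous fun z : ℂ => 2 * (1 - ‖z‖) ^ α + 2 * K * (1 - ‖z‖) := by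
      have : Continuous fun z : ℂ => (1 - ‖z‖) ^ α :=
        (continuous_const.sub continuous_norm).rpow_const fun _ => Or.inr hα0.le
      fun_prop
    have := hc.tendsto ξ
    simpa [hξ, Real.zero_rpow hα0.ne'] using this
  refine squeeze_zero' ?_ ?_ (hlim.mono_left nhdsWithin_le_nhds)
  · filter_upwards [self_mem_nhdsWithin] with z hz
    exact osc_nonneg (by simpa using hz)
  · filter_upwards [self_mem_nhdsWithin] with z hz
    have hz : ‖z‖ < 1 := by simpa using hz
    have h1 := h z hz
    have hp := one_sub_sq_pos hz
    have ht : 0 < 1 - ‖z‖ := by linarith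
    rw [div_le_iff₀ hp] at h1
    refine h1.trans ?_
    rw [one_mul, Real.rpow_sub_one ht.ne']
    have e : ((1 - ‖z‖) ^ α / (1 - ‖z‖) + K) * (1 - ‖z‖ ^ 2) =
        (1 + ‖z‖) * (1 - ‖z‖) ^ α + (1 + ‖z‖) * K * (1 - ‖z‖) := by
      field_simp
      ring
    rw [e]
    gcongr <;> linarith

theorem norm_le_of_tendsto_flatOuter (hα0 : 0 < α) (hα1 : α ≤ 1/2) (hL : LittleLip α f)
    {ξ : ℂ} (hξ : ‖ξ‖ = 1) :
    Tendsto (fun z : ℂ => (c * (‖f z‖ + osc f z + (1 - ‖z‖))) ^ N) (𝓝[ball 0 1] ξ)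
      (𝓝 ((c * ‖f ξ‖) ^ N)) ∧
    ∀ᶠ z in 𝓝[ball 0 1] ξ, ‖flatOuter f N c z‖ ≤ (c * (‖f z‖ + osc f z + (1 - ‖z‖))) ^ N := by
  constructor
  · have h1 : Tendsto f (𝓝[ball 0 1] ξ) (𝓝 (f ξ)) :=
      (hf.2 ξ (by simp [hξ])).mono_left (nhdsWithin_mono _ ball_subset_closedBall)
    have h2 : Tendsto (fun z : ℂ => 1 - ‖z‖) (𝓝[ball 0 1] ξ) (𝓝 0) := by
      have : Tendsto (fun z : ℂ => 1 - ‖z‖) (𝓝 ξ) (𝓝 (1 - ‖ξ‖)) :=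
        (continuous_const.sub continuous_norm).tendsto ξ
      rw [hξ, sub_self] at this
      exact this.mono_left nhdsWithin_le_nhds
    have h3 := ((h1.norm.add (tendsto_osc hf hα0 hα1 hL hξ)).add h2).const_mul c
    rw [add_zero, add_zero] at h3
    exact h3.rpow_const (Or.inr hN)
  · filter_upwards [self_mem_nhdsWithin] with z hz
    have hz : ‖z‖ < 1 := by simpa using hz
    have := osc_nonneg (f := f) hz
    exact norm_flatOuter_le_rpow hf hN hc1 hz₀ hfz₀ hz (by linarith)
      (by linarith [norm_nonneg (f z)])

theorem exists_tendsto_flatOuter (hα0 : 0 < α) (hα1 : α ≤ 1/2) (hL : LittleLip α f)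
    (hN0 : 0 < N) {ξ : ℂ} (hξ : ‖ξ‖ ≤ 1) :
    ∃ y, Tendsto (flatOuter f N c) (𝓝[ball 0 1] ξ) (𝓝 y) := by
  by_cases hfξ : f ξ = 0
  · rcases hξ.lt_or_eq with h | h
    · exact ⟨_, (hasDerivAt_flatOuter hf hN hc1 hz₀ hfz₀ h).continuousAt.continuousWithinAt⟩
    · obtain ⟨h1, h2⟩ := norm_le_of_tendsto_flatOuter hf hN hc1 hz₀ hfz₀ hα0 hα1 hL h
      rw [hfξ, norm_zero, mul_zero, Real.zero_rpow hN0.ne'] at h1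
      exact ⟨0, squeeze_zero_norm' h2 h1⟩
  · have hξ' : ξ ∈ closedBall (0:ℂ) 1 := by simpa using hξ
    obtain ⟨y, hy⟩ := (smallGrowth_deriv_mul_flatOuter hf hN hc1 hz₀ hfz₀ hα0 hα1
      hL).exists_tendsto hα0 hα1 (differentiableOn_mul_flatOuter hf hN hc1 hz₀ hfz₀) hξ'
    have h1 : Tendsto f (𝓝[ball 0 1] ξ) (𝓝 (f ξ)) :=
      (hf.2 ξ hξ').mono_left (nhdsWithin_mono _ ball_subset_closedBall)
    refine ⟨y / f ξ, (hy.div h1 hfξ).congr' ?_⟩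
    filter_upwards [h1.eventually_ne hfξ] with z hz
    exact mul_div_cancel_left₀ _ hz

/-- The continuous extension of `flatOuter` to the closed disc. -/
theorem exists_flatOuter_extension (hα0 : 0 < α) (hα1 : α ≤ 1/2) (hL : LittleLip α f)
    (hN0 : 0 < N) : ∃ g : ℂ → ℂ, EqOn g (flatOuter f N c) (ball 0 1) ∧ IsDiscReg g ∧
      ∀ ξ, ‖ξ‖ = 1 → ‖g ξ‖ ≤ (c * ‖f ξ‖) ^ N := by
  have hd : DifferentiableOn ℂ (flatOuter f N c) (ball 0 1) := fun z hz =>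
    (hasDerivAt_flatOuter hf hN hc1 hz₀ hfz₀
      (by simpa using hz)).differentiableAt.differentiableWithinAt
  have hlim : ∀ ξ ∈ closedBall (0:ℂ) 1, ∃ y, Tendsto (flatOuter f N c) (𝓝[ball 0 1] ξ) (𝓝 y) :=
    fun ξ hξ => exists_tendsto_flatOuter hf hN hc1 hz₀ hfz₀ hα0 hα1 hL hN0 (by simpa using hξ)
  have hcl : closedBall (0:ℂ) 1 ⊆ closure (ball 0 1) := by rw [closure_ball 0 one_ne_zero]
  have heq : EqOn (extendFrom (ball 0 1) (flatOuter f N c)) (flatOuter f N c) (ball 0 1) :=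
    fun z hz => extendFrom_eq (subset_closure hz) (hd.continuousOn z hz)
  refine ⟨extendFrom (ball 0 1) (flatOuter f N c), heq, ⟨hd.congr heq,
    continuousOn_extendFrom hcl hlim⟩, fun ξ hξ => ?_⟩
  have hξ' : ξ ∈ closedBall (0:ℂ) 1 := by simp [hξ]
  obtain ⟨h1, h2⟩ := norm_le_of_tendsto_flatOuter hf hN hc1 hz₀ hfz₀ hα0 hα1 hL hξ
  have hne : (𝓝[ball (0:ℂ) 1] ξ).NeBot := mem_closure_iff_nhdsWithin_neBot.1 (hcl hξ')
  exact le_of_tendsto_of_tendsto (tendsto_extendFrom (hlim ξ hξ')).norm h1 h2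

end Outer

end BoundaryFlat

namespace BoundaryFlat

open scoped Real Topology

section Parseval

theorem integral_sq_norm_sum (b : ℕ → ℂ) (n : ℕ) :
    ∫ θ, ‖∑ k ∈ Finset.range n, b k * circleMap 0 1 θ ^ k‖ ^ 2 ∂circProb =
      ∑ k ∈ Finset.range n, ‖b k‖ ^ 2 := by
  set p : Polynomial ℂ := ∑ k ∈ Finset.range n, Polynomial.C (b k) * Polynomial.X ^ k with hp
  have hcoeff : ∀ i, p.coeff i = if i < n then b i else 0 := fun i => by
    simp [hp, Polynomial.coeff_X_pow]
  have h_ev : ∀ z, p.eval z = ∑ k ∈ Finset.range n, b k * z ^ k := fun z => by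
    simp [hp, Polynomial.eval_finsetSum]
  have h := p.sum_sq_norm_coeff_eq_circleAverage
  rw [circleAverage_eq_integral] at h
  simp only [h_ev] at h
  rw [← h]
  have hsub : p.support ⊆ Finset.range n := fun i hi => by
    rw [Polynomial.mem_support_iff, hcoeff] at hi
    rw [Finset.mem_range]
    by_contra hlt
    simp [hlt] at hi
  rw [Finset.sum_subset hsub fun i _ hi => by
    rw [Polynomial.notMem_support_iff.1 hi, norm_zero, zero_pow two_ne_zero]]
  exact Finset.sum_congr rfl fun i hi => by rw [hcoeff, if_pos (Finset.mem_range.1 hi)]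

/-- Parseval's identity for absolutely convergent power series on the unit circle. -/
theorem hasSum_sq_norm {b : ℕ → ℂ} (hb : Summable fun k => ‖b k‖) :
    HasSum (fun k => ‖b k‖ ^ 2)
      (∫ θ, ‖∑' k, b k * circleMap 0 1 θ ^ k‖ ^ 2 ∂circProb) := by
  have hn : ∀ θ k, ‖b k * circleMap 0 1 θ ^ k‖ = ‖b k‖ := fun θ k => by simp
  have hs : ∀ θ, Summable fun k => b k * circleMap 0 1 θ ^ k := fun θ =>
    Summable.of_norm (by simpa only [hn] using hb)
  rw [hasSum_iff_tendsto_nat_of_nonneg fun k => sq_nonneg _]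
  simp only [← integral_sq_norm_sum]
  refine tendsto_integral_of_dominated_convergence (fun _ => (∑' k, ‖b k‖) ^ 2) (fun n => ?_)
    (integrable_const _) (fun n => ae_of_all _ fun θ => ?_) (ae_of_all _ fun θ => ?_)
  · have : Continuous fun θ => ‖∑ k ∈ Finset.range n, b k * circleMap 0 1 θ ^ k‖ ^ 2 := by
      have := continuous_circleMap 0 1
      fun_prop
    exact this.aestronglyMeasurable
  · rw [norm_pow, norm_norm]
    gcongr
    refine (norm_sum_le _ _).trans ?_
    simp only [hn]
    exact hb.sum_le_tsum _ fun _ _ => norm_nonneg _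
  · exact ((hs θ).hasSum.tendsto_sum_nat.norm).pow 2

theorem lintegral_sq_norm {b : ℕ → ℂ} (hb : Summable fun k => ‖b k‖) :
    ∫⁻ θ, ENNReal.ofReal (‖∑' k, b k * circleMap 0 1 θ ^ k‖ ^ 2) ∂circProb =
      ∑' k, ENNReal.ofReal (‖b k‖ ^ 2) := by
  have h := hasSum_sq_norm hb
  have hc : Continuous fun θ => ∑' k, b k * circleMap 0 1 θ ^ k := by
    refine continuous_tsum (fun k => ?_) hb fun k θ => by simp
    have := continuous_circleMap 0 1
    fun_prop
  rw [← ENNReal.ofReal_tsum_of_nonneg (fun k => sq_nonneg _) h.summable, h.tsum_eq,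
    ofReal_integral_eq_lintegral_ofReal _ (ae_of_all _ fun θ => sq_nonneg _)]
  exact integrable_circProb_of_continuous (hc.norm.pow 2)

end Parseval

section Coefficients

/-- The Taylor coefficients at the origin. -/
noncomputable def taylorCoeff (F : ℂ → ℂ) (k : ℕ) : ℂ := (k.factorial : ℂ)⁻¹ * iteratedDeriv k F 0

variable {F : ℂ → ℂ}

theorem hasSum_taylorCoeff (hF : DifferentiableOn ℂ F (ball 0 1)) {z : ℂ} (hz : ‖z‖ < 1) :
    HasSum (fun k => taylorCoeff F k * z ^ k) (F z) := by
  have := Complex.hasSum_taylorSeries_on_ball hF (z := z) (by simpa using hz)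
  refine this.congr_fun fun k => ?_
  simp only [taylorCoeff, smul_eq_mul, sub_zero]
  ring

theorem summable_norm_taylorCoeff (hF : DifferentiableOn ℂ F (ball 0 1)) {r : ℝ} (h0 : 0 ≤ r)
    (h1 : r < 1) : Summable fun k => ‖taylorCoeff F k‖ * r ^ k := by
  have h := (hasSum_taylorCoeff hF (z := r)
    (by rwa [norm_real, Real.norm_of_nonneg h0])).summable.norm
  simpa [abs_of_nonneg h0] using h

theorem taylorCoeff_deriv (F : ℂ → ℂ) (k : ℕ) :
    taylorCoeff (deriv F) k = (k + 1) * taylorCoeff F (k + 1) := by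
  have h : (k.factorial : ℂ) ≠ 0 := by exact_mod_cast k.factorial_ne_zero
  have h2 : (k + 1 : ℂ) ≠ 0 := by exact_mod_cast k.succ_ne_zero
  rw [taylorCoeff, taylorCoeff, iteratedDeriv_succ', Nat.factorial_succ]
  push_cast
  field_simp

theorem lintegral_sq_norm_circle (hF : DifferentiableOn ℂ F (ball 0 1)) {r : ℝ} (h0 : 0 ≤ r)
    (h1 : r < 1) : ∫⁻ θ, ENNReal.ofReal (‖F (r * circleMap 0 1 θ)‖ ^ 2) ∂circProb =
      ∑' k, ENNReal.ofReal (‖taylorCoeff F k‖ ^ 2 * r ^ (2 * k)) := by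
  have h := lintegral_sq_norm (b := fun k => taylorCoeff F k * (r : ℂ) ^ k) (by
    simpa [abs_of_nonneg h0] using summable_norm_taylorCoeff hF h0 h1)
  have e1 : ∀ θ, ∑' k, taylorCoeff F k * (r : ℂ) ^ k * circleMap 0 1 θ ^ k =
      F (r * circleMap 0 1 θ) := fun θ => by
    rw [← (hasSum_taylorCoeff hF (z := r * circleMap 0 1 θ) (by simp [abs_of_nonneg h0, h1])).tsum_eq]
    simp only [mul_pow, mul_assoc]
  simp only [e1] at h
  rw [h]
  congr 1 with k
  rw [norm_mul, norm_pow, norm_real, Real.norm_of_nonneg h0, mul_pow, ← pow_mul, mul_comm k]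

theorem lintegral_sq_norm_sub_circle_le (hF : DifferentiableOn ℂ F (ball 0 1))
    (hFc : Continuous F) {w : ℂ} (hw : ‖w‖ < 1) :
    ∫⁻ θ, ENNReal.ofReal (‖F (circleMap 0 1 θ) - F (circleMap 0 1 θ * w)‖ ^ 2) ∂circProb ≤
      ∑' k, ENNReal.ofReal (‖taylorCoeff F k‖ ^ 2 * ‖1 - w ^ k‖ ^ 2) := by
  have hr : ∀ n : ℕ, 0 ≤ 1 - 1 / ((n : ℝ) + 1) ∧ 1 - 1 / ((n : ℝ) + 1) < 1 := fun n => by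
    have h1 : 0 < 1 / ((n : ℝ) + 1) := Nat.one_div_pos_of_nat
    have h2 : 1 / ((n : ℝ) + 1) ≤ 1 := by
      rw [div_le_one (by positivity)]
      linarith [(Nat.cast_nonneg n : (0:ℝ) ≤ n)]
    constructor <;> linarith
  have hlim : Tendsto (fun n : ℕ => 1 - 1 / ((n : ℝ) + 1)) atTop (𝓝 1) := by
    simpa using tendsto_one_div_add_atTop_nhds_zero_nat.const_sub (1:ℝ)
  have hcirc := continuous_circleMap 0 1
  have hle : ∀ r : ℝ, 0 ≤ r → r < 1 →
      ∫⁻ θ, ENNReal.ofReal (‖F (r * circleMap 0 1 θ) - F (r * (circleMap 0 1 θ * w))‖ ^ 2)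
        ∂circProb ≤ ∑' k, ENNReal.ofReal (‖taylorCoeff F k‖ ^ 2 * ‖1 - w ^ k‖ ^ 2) := by
    intro r h0 h1
    have hw2 : ∀ k, ‖1 - w ^ k‖ ≤ 2 := fun k => by
      refine (norm_sub_le _ _).trans ?_
      rw [norm_one, norm_pow]
      linarith [pow_le_one₀ (norm_nonneg w) hw.le (n := k)]
    have h := lintegral_sq_norm (b := fun k => taylorCoeff F k * (r : ℂ) ^ k * (1 - w ^ k)) (by
      refine Summable.of_nonneg_of_le (fun k => norm_nonneg _) (fun k => ?_)
        ((summable_norm_taylorCoeff hF h0 h1).mul_right 2)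
      rw [norm_mul, norm_mul, norm_pow, norm_real, Real.norm_of_nonneg h0]
      gcongr
      exact hw2 k)
    have e1 : ∀ θ, ∑' k, taylorCoeff F k * (r : ℂ) ^ k * (1 - w ^ k) * circleMap 0 1 θ ^ k =
        F (r * circleMap 0 1 θ) - F (r * (circleMap 0 1 θ * w)) := fun θ => by
      have a1 : ‖(r : ℂ) * circleMap 0 1 θ‖ < 1 := by simp [abs_of_nonneg h0, h1]
      have a2 : ‖(r : ℂ) * (circleMap 0 1 θ * w)‖ < 1 := by
        rw [← mul_assoc, norm_mul]
        nlinarith [norm_nonneg w, norm_nonneg ((r : ℂ) * circleMap 0 1 θ)]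
      rw [← ((hasSum_taylorCoeff hF a1).sub (hasSum_taylorCoeff hF a2)).tsum_eq]
      congr 1 with k
      simp only [mul_pow]
      ring
    simp only [e1] at h
    rw [h]
    refine ENNReal.tsum_le_tsum fun k => ENNReal.ofReal_le_ofReal ?_
    rw [norm_mul, norm_mul, norm_pow, norm_real, Real.norm_of_nonneg h0, ← mul_pow]
    gcongr
    exact mul_le_of_le_one_right (norm_nonneg _) (pow_le_one₀ h0 h1.le)
  have hpt : ∀ θ, Tendsto (fun n : ℕ => ENNReal.ofReal
      (‖F ((1 - 1 / ((n : ℝ) + 1) : ℝ) * circleMap 0 1 θ) -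
        F ((1 - 1 / ((n : ℝ) + 1) : ℝ) * (circleMap 0 1 θ * w))‖ ^ 2)) atTop
      (𝓝 (ENNReal.ofReal (‖F (circleMap 0 1 θ) - F (circleMap 0 1 θ * w)‖ ^ 2))) := fun θ => by
    have hc : Continuous fun r : ℝ => ENNReal.ofReal
        (‖F (r * circleMap 0 1 θ) - F (r * (circleMap 0 1 θ * w))‖ ^ 2) :=
      ENNReal.continuous_ofReal.comp (by fun_prop)
    have := (hc.tendsto 1).comp hlim
    simpa only [Function.comp_def, ofReal_one, one_mul] using this
  calc _ = ∫⁻ θ, liminf (fun n : ℕ => ENNReal.ofReal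
      (‖F ((1 - 1 / ((n : ℝ) + 1) : ℝ) * circleMap 0 1 θ) -
        F ((1 - 1 / ((n : ℝ) + 1) : ℝ) * (circleMap 0 1 θ * w))‖ ^ 2)) atTop ∂circProb :=
        lintegral_congr fun θ => (hpt θ).liminf_eq.symm
    _ ≤ liminf (fun n : ℕ => ∫⁻ θ, ENNReal.ofReal
      (‖F ((1 - 1 / ((n : ℝ) + 1) : ℝ) * circleMap 0 1 θ) -
        F ((1 - 1 / ((n : ℝ) + 1) : ℝ) * (circleMap 0 1 θ * w))‖ ^ 2) ∂circProb) atTop := by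
        refine lintegral_liminf_le fun n => ?_
        have : Continuous fun θ => ENNReal.ofReal
          (‖F ((1 - 1 / ((n : ℝ) + 1) : ℝ) * circleMap 0 1 θ) -
            F ((1 - 1 / ((n : ℝ) + 1) : ℝ) * (circleMap 0 1 θ * w))‖ ^ 2) :=
          ENNReal.continuous_ofReal.comp (by fun_prop)
        exact this.measurable
    _ ≤ _ := liminf_le_of_le (by isBoundedDefault) fun b hb => by
        obtain ⟨n, hn⟩ := hb.exists
        exact hn.trans (hle _ (hr n).1 (hr n).2)

end Coefficients

section Polar

theorem lintegral_Ioo_eq_circProb (u : ℝ → ℝ≥0∞) :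
    ∫⁻ θ in Ioo (-π) π, u θ = ENNReal.ofReal (2 * π) * ∫⁻ θ, u θ ∂circProb := by
  rw [circProb, lintegral_smul_measure, smul_eq_mul, ← mul_assoc,
    ← ENNReal.ofReal_mul (by positivity), mul_inv_cancel₀ (by positivity), ENNReal.ofReal_one,
    one_mul, setLIntegral_congr Ioo_ae_eq_Ioc]

theorem lintegral_ball_eq {u : ℂ → ℝ≥0∞} (hu : Measurable u) :
    ∫⁻ z in ball 0 1, u z = ∫⁻ ρ in Ioo (0:ℝ) 1, ENNReal.ofReal (2 * π * ρ) *
      ∫⁻ θ, u (ρ * circleMap 0 1 θ) ∂circProb := by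
  have hcm : ∀ ρ θ : ℝ, (ρ : ℂ) * (Real.cos θ + Real.sin θ * I) = ρ * circleMap 0 1 θ :=
    fun ρ θ => by simp [circleMap, Complex.exp_mul_I]
  have hcont := continuous_circleMap 0 1
  have hcm2 : Continuous fun p : ℝ × ℝ => (p.1 : ℂ) * circleMap 0 1 p.2 := by fun_prop
  have hmeas : Measurable ((ball (0:ℂ) 1).indicator u) := hu.indicator measurableSet_ball
  rw [← lintegral_indicator measurableSet_ball, ← Complex.lintegral_comp_polarCoord_symm,
    polarCoord_target, Measure.volume_eq_prod, ← Measure.prod_restrict]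
  simp only [Complex.polarCoord_symm_apply, hcm, smul_eq_mul]
  have hm : Measurable fun p : ℝ × ℝ => ENNReal.ofReal p.1 *
      (ball (0:ℂ) 1).indicator u (p.1 * circleMap 0 1 p.2) :=
    (measurable_fst.ennreal_ofReal).mul (hmeas.comp hcm2.measurable)
  rw [lintegral_prod _ hm.aemeasurable]
  have e : ∀ ρ ∈ Ioi (0:ℝ), ∫⁻ θ in Ioo (-π) π, ENNReal.ofReal ρ *
      (ball (0:ℂ) 1).indicator u (ρ * circleMap 0 1 θ) = (Ioo (0:ℝ) 1).indicator
        (fun ρ => ENNReal.ofReal (2 * π * ρ) * ∫⁻ θ, u (ρ * circleMap 0 1 θ) ∂circProb) ρ := by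
    intro ρ hρ
    have hρ : 0 < ρ := hρ
    rw [lintegral_const_mul' _ _ ENNReal.ofReal_ne_top]
    by_cases h1 : ρ < 1
    · rw [indicator_of_mem (show ρ ∈ Ioo (0:ℝ) 1 from ⟨hρ, h1⟩)]
      have : ∀ θ, (ρ * circleMap 0 1 θ : ℂ) ∈ ball (0:ℂ) 1 := fun θ => by
        simp [abs_of_pos hρ, h1]
      simp only [indicator_of_mem (this _)]
      rw [lintegral_Ioo_eq_circProb, ← mul_assoc, ← ENNReal.ofReal_mul hρ.le, mul_comm ρ]
    · rw [indicator_of_notMem (show ρ ∉ Ioo (0:ℝ) 1 from fun h => h1 h.2)]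
      have : ∀ θ, (ρ * circleMap 0 1 θ : ℂ) ∉ ball (0:ℂ) 1 := fun θ => by
        simpa [abs_of_pos hρ] using h1
      simp only [indicator_of_notMem (this _), lintegral_zero, mul_zero]
  rw [setLIntegral_congr_fun measurableSet_Ioi e, lintegral_indicator measurableSet_Ioo,
    Measure.restrict_restrict measurableSet_Ioo, inter_eq_left.2 Ioo_subset_Ioi_self]

end Polar

end BoundaryFlat

namespace BoundaryFlat

open scoped Real Topology

section CoefficientSum

variable {F : ℂ → ℂ}

theorem lintegral_Ioo_pow (n : ℕ) :
    ∫⁻ ρ in Ioo (0:ℝ) 1, ENNReal.ofReal (ρ ^ n) = ENNReal.ofReal (1 / (n + 1)) := by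
  rw [setLIntegral_congr Ioo_ae_eq_Ioc, ← ofReal_integral_eq_lintegral_ofReal]
  · rw [← intervalIntegral.integral_of_le zero_le_one, integral_pow]
    simp
  · exact (continuous_pow n).integrableOn_Icc.mono_set Ioc_subset_Icc_self
  · exact (ae_restrict_mem measurableSet_Ioc).mono fun t ht => pow_nonneg ht.1.le _

theorem lintegral_sq_norm_deriv (hF : DifferentiableOn ℂ F (ball 0 1)) :
    ∫⁻ z in ball 0 1, ENNReal.ofReal (‖deriv F z‖ ^ 2) =
      ∑' k : ℕ, ENNReal.ofReal (π * ((k + 1 : ℝ) * ‖taylorCoeff F (k + 1)‖ ^ 2)) := by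
  have hF' : DifferentiableOn ℂ (deriv F) (ball 0 1) := hF.deriv isOpen_ball
  rw [lintegral_ball_eq ((measurable_deriv F).norm.pow_const 2).ennreal_ofReal]
  have e : ∀ ρ ∈ Ioo (0:ℝ) 1, ENNReal.ofReal (2 * π * ρ) *
      ∫⁻ θ, ENNReal.ofReal (‖deriv F (ρ * circleMap 0 1 θ)‖ ^ 2) ∂circProb =
      ∑' k : ℕ, ENNReal.ofReal (2 * π * ‖taylorCoeff (deriv F) k‖ ^ 2) *
        ENNReal.ofReal (ρ ^ (2 * k + 1)) := fun ρ hρ => by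
    rw [lintegral_sq_norm_circle hF' hρ.1.le hρ.2, ← ENNReal.tsum_mul_left]
    congr 1 with k
    rw [← ENNReal.ofReal_mul (by have := hρ.1; positivity), ← ENNReal.ofReal_mul (by positivity)]
    congr 1
    ring
  have hm : ∀ k : ℕ, Measurable fun ρ : ℝ =>
      ENNReal.ofReal (2 * π * ‖taylorCoeff (deriv F) k‖ ^ 2) * ENNReal.ofReal (ρ ^ (2 * k + 1)) :=
    fun k => ((measurable_id.pow_const _).ennreal_ofReal).const_mul _
  rw [setLIntegral_congr_fun measurableSet_Ioo e, lintegral_tsum fun k => (hm k).aemeasurable]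
  congr 1 with k
  rw [lintegral_const_mul' _ _ ENNReal.ofReal_ne_top, lintegral_Ioo_pow,
    ← ENNReal.ofReal_mul (by positivity), taylorCoeff_deriv, norm_mul]
  congr 1
  have : ‖(k + 1 : ℂ)‖ = k + 1 := by exact_mod_cast Complex.norm_natCast (k + 1)
  rw [this]
  push_cast
  field_simp
  ring

theorem tsum_mul_sq_norm_taylorCoeff_lt_top (hF : DifferentiableOn ℂ F (ball 0 1))
    (h : ∫⁻ z in ball 0 1, ENNReal.ofReal (‖deriv F z‖ ^ 2) < ⊤) :
    ∑' k : ℕ, ENNReal.ofReal ((k : ℝ) * ‖taylorCoeff F k‖ ^ 2) < ⊤ := by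
  rw [lintegral_sq_norm_deriv hF] at h
  simp only [ENNReal.ofReal_mul Real.pi_pos.le] at h
  rw [ENNReal.tsum_mul_left] at h
  rw [tsum_eq_zero_add' ENNReal.summable]
  have h2 := ENNReal.lt_top_of_mul_ne_top_right h.ne (by simpa using Real.pi_pos)
  simpa using h2

end CoefficientSum

section KernelEstimate

theorem norm_one_sub_pow_le {w : ℂ} (hw : ‖w‖ ≤ 1) (k : ℕ) : ‖1 - w ^ k‖ ≤ k * ‖1 - w‖ := by
  induction k with
  | zero => simp
  | succ k ih =>
    have : 1 - w ^ (k + 1) = (1 - w ^ k) * w + (1 - w) := by ring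
    rw [this]
    refine (norm_add_le _ _).trans ?_
    rw [norm_mul]
    push_cast
    have := mul_le_of_le_one_right (norm_nonneg (1 - w ^ k)) hw
    linarith

theorem norm_one_sub_mul_circleMap (ρ θ : ℝ) :
    ‖1 - ρ * circleMap 0 1 θ‖ = ‖circleMap 0 1 θ - ρ‖ := by
  have h : circleMap 0 1 θ * starRingEnd ℂ (circleMap 0 1 θ) = 1 := by
    rw [Complex.mul_conj, Complex.normSq_eq_norm_sq, norm_circleMap_one]
    simp
  have e : circleMap 0 1 θ - ρ =
      circleMap 0 1 θ * starRingEnd ℂ (1 - ρ * circleMap 0 1 θ) := by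
    rw [map_sub, map_mul, map_one, conj_ofReal]
    linear_combination (ρ : ℂ) * h
  rw [e, norm_mul, norm_circleMap_one, one_mul, RCLike.norm_conj]

theorem kernel_le {ρ θ : ℝ} (h0 : 0 ≤ ρ) (h1 : ρ < 1) (hθ : |θ| ≤ π) (hθ0 : θ ≠ 0) (k : ℕ) :
    ‖1 - ρ * circleMap 0 1 θ‖ ^ (-(5/2) : ℝ) * ‖1 - (ρ * circleMap 0 1 θ) ^ k‖ ^ 2 ≤
      64 * (min ((1 - ρ) ^ (-(5/4) : ℝ)) (k * (1 - ρ) ^ (-(1/4) : ℝ)) *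
        min (|θ| ^ (-((1/4 : ℝ) + 1))) (k * |θ| ^ (-(1/4) : ℝ))) := by
  set w : ℂ := ρ * circleMap 0 1 θ with hw
  have hwn : ‖w‖ ≤ 1 := by simp [hw, abs_of_nonneg h0, h1.le]
  have hx : ‖1 - w‖ = ‖circleMap 0 1 θ - ρ‖ := norm_one_sub_mul_circleMap ρ θ
  have ht : 0 < 1 - ρ := by linarith
  have hxt : 1 - ρ ≤ ‖1 - w‖ := by
    rw [hx]
    have := one_sub_norm_le (ρ : ℂ) θ
    rwa [norm_real, Real.norm_of_nonneg h0] at this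
  set x := ‖1 - w‖ with hxdef
  have hx0 : 0 < x := ht.trans_le hxt
  have hy1 : ‖1 - w ^ k‖ ≤ k * x := norm_one_sub_pow_le hwn k
  have hy2 : ‖1 - w ^ k‖ ≤ 2 := by
    refine (norm_sub_le _ _).trans ?_
    rw [norm_one, norm_pow]
    linarith [pow_le_one₀ (norm_nonneg w) hwn (n := k)]
  set y := ‖1 - w ^ k‖ with hydef
  have hy0 : 0 ≤ y := norm_nonneg _
  have hp : x ^ (-(5/4) : ℝ) * x = x ^ (-(1/4) : ℝ) := by
    rw [← Real.rpow_add_one hx0.ne']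
    norm_num
  have hsq : x ^ (-(5/2) : ℝ) * y ^ 2 = (x ^ (-(5/4) : ℝ) * y) ^ 2 := by
    rw [mul_pow, ← Real.rpow_natCast (x ^ (-(5/4) : ℝ)), ← Real.rpow_mul hx0.le]
    norm_num
  have hpos : 0 ≤ x ^ (-(5/4) : ℝ) := by positivity
  have hm1 : x ^ (-(5/4) : ℝ) * y ≤ 2 * x ^ (-(5/4) : ℝ) := by nlinarith
  have hm2 : x ^ (-(5/4) : ℝ) * y ≤ k * x ^ (-(1/4) : ℝ) := by
    rw [← hp]
    nlinarith
  have hk : (0:ℝ) ≤ k := Nat.cast_nonneg k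
  have b1 : x ^ (-(5/4) : ℝ) * y ≤
      2 * min ((1 - ρ) ^ (-(5/4) : ℝ)) (k * (1 - ρ) ^ (-(1/4) : ℝ)) := by
    rw [mul_min_of_nonneg _ _ (by norm_num)]
    have a1 : x ^ (-(5/4) : ℝ) ≤ (1 - ρ) ^ (-(5/4) : ℝ) :=
      Real.rpow_le_rpow_of_nonpos ht hxt (by norm_num)
    have a2 : x ^ (-(1/4) : ℝ) ≤ (1 - ρ) ^ (-(1/4) : ℝ) :=
      Real.rpow_le_rpow_of_nonpos ht hxt (by norm_num)
    have a3 : 0 ≤ (k : ℝ) * (1 - ρ) ^ (-(1/4) : ℝ) := by positivity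
    have a4 := mul_le_mul_of_nonneg_left a2 hk
    exact le_min (by linarith) (by linarith)
  have b2 : x ^ (-(5/4) : ℝ) * y ≤
      32 * min (|θ| ^ (-((1/4 : ℝ) + 1))) (k * |θ| ^ (-(1/4) : ℝ)) := by
    rw [mul_min_of_nonneg _ _ (by norm_num), show -((1/4 : ℝ) + 1) = -(5/4) by norm_num]
    have a1 : x ^ (-(5/4) : ℝ) ≤ 16 * |θ| ^ (-(5/4) : ℝ) := by
      rw [hx]
      exact rpow_neg_norm_sub_le hθ hθ0 h0 h1 (by norm_num) (by norm_num)
    have a2 : x ^ (-(1/4) : ℝ) ≤ 16 * |θ| ^ (-(1/4) : ℝ) := by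
      rw [hx]
      exact rpow_neg_norm_sub_le hθ hθ0 h0 h1 (by norm_num) (by norm_num)
    have a3 : 0 ≤ (k : ℝ) * |θ| ^ (-(1/4) : ℝ) := by positivity
    have a4 := mul_le_mul_of_nonneg_left a2 hk
    exact le_min (by linarith) (by linarith)
  rw [hsq, sq]
  calc _ ≤ _ := mul_le_mul b1 b2 (by positivity) ((by positivity : (0:ℝ) ≤ _).trans b1)
    _ = _ := by ring

theorem lintegral_Ioo_one_sub_le (G : ℝ → ℝ≥0∞) :
    ∫⁻ ρ in Ioo (0:ℝ) 1, G (1 - ρ) ≤ ∫⁻ t in Ioi (0:ℝ), G t := by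
  rw [← lintegral_indicator measurableSet_Ioo, ← lintegral_indicator measurableSet_Ioi,
    ← lintegral_sub_left_eq_self ((Ioi (0:ℝ)).indicator G) 1]
  refine lintegral_mono fun ρ => ?_
  by_cases h : ρ ∈ Ioo (0:ℝ) 1
  · rw [indicator_of_mem h, indicator_of_mem (by simpa using h.2)]
  · rw [indicator_of_notMem h]
    exact zero_le

/-- The double kernel integral controlling the `k`-th Taylor coefficient. -/
noncomputable def circleKernel (k : ℕ) (ρ : ℝ) : ℝ≥0∞ :=
  ∫⁻ θ, ENNReal.ofReal (‖1 - ρ * circleMap 0 1 θ‖ ^ (-(5/2) : ℝ) *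
    ‖1 - (ρ * circleMap 0 1 θ) ^ k‖ ^ 2) ∂circProb

theorem circleKernel_le {k : ℕ} (hk : 0 < k) {ρ : ℝ} (h0 : 0 ≤ ρ) (h1 : ρ < 1) :
    circleKernel k ρ ≤ ENNReal.ofReal (128 * ((1 / (1 - 1/4) + 1 / (1/4)) * (k : ℝ) ^ (1/4 : ℝ))) *
      ENNReal.ofReal (min ((1 - ρ) ^ (-(5/4) : ℝ)) (k * (1 - ρ) ^ (-(1/4) : ℝ))) := by
  set m := min ((1 - ρ) ^ (-(5/4) : ℝ)) (k * (1 - ρ) ^ (-(1/4) : ℝ)) with hm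
  have ht : 0 < 1 - ρ := by linarith
  have hm0 : 0 ≤ m := le_min (by positivity) (by positivity)
  refine (lintegral_circProb_le _).trans ?_
  have h3 : ∀ᵐ θ ∂(volume.restrict (Ioc (-π) π)),
      ENNReal.ofReal (‖1 - ρ * circleMap 0 1 θ‖ ^ (-(5/2) : ℝ) *
        ‖1 - (ρ * circleMap 0 1 θ) ^ k‖ ^ 2) ≤ ENNReal.ofReal (64 * m) *
        ENNReal.ofReal (min (|θ| ^ (-((1/4 : ℝ) + 1))) (k * |θ| ^ (-(1/4) : ℝ))) := by
    have hne : ∀ᵐ θ ∂(volume.restrict (Ioc (-π) π)), θ ≠ 0 :=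
      ae_restrict_of_ae (Measure.ae_ne volume 0)
    filter_upwards [ae_restrict_mem measurableSet_Ioc, hne] with θ hθ hθ0
    rw [← ENNReal.ofReal_mul (by positivity), mul_assoc]
    exact ENNReal.ofReal_le_ofReal (kernel_le h0 h1 (abs_le.2 ⟨hθ.1.le, hθ.2⟩) hθ0 k)
  refine (lintegral_mono_ae h3).trans ?_
  rw [lintegral_const_mul' _ _ ENNReal.ofReal_ne_top]
  have h4 := lintegral_comp_abs_le _ (measurable_min_rpow (1/4) k)
  have h5 := lintegral_min_rpow_le (s := 1/4) (k := k) (by norm_num) (by norm_num)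
    (by exact_mod_cast hk)
  calc _ ≤ ENNReal.ofReal (64 * m) * (2 * ENNReal.ofReal ((1 / (1 - 1/4) + 1 / (1/4)) *
          (k : ℝ) ^ (1/4 : ℝ))) := by
        gcongr
        exact (setLIntegral_le_lintegral _ _).trans (h4.trans (by gcongr))
    _ = _ := by
        rw [show (2 : ℝ≥0∞) = ENNReal.ofReal 2 by simp, ← ENNReal.ofReal_mul (by norm_num),
          ← ENNReal.ofReal_mul (by positivity), ← ENNReal.ofReal_mul (by positivity)]
        congr 1
        ring

theorem exists_lintegral_circleKernel_le : ∃ C : ℝ, 0 < C ∧ ∀ k : ℕ,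
    ∫⁻ ρ in Ioo (0:ℝ) 1, ENNReal.ofReal ((1 - ρ) ^ (-(1/2) : ℝ)) * circleKernel k ρ ≤
      ENNReal.ofReal (C * k) := by
  refine ⟨128 * (1 / (1 - 1/4) + 1 / (1/4)) * (1 / (1 - 3/4) + 1 / (3/4)), by norm_num,
    fun k => ?_⟩
  rcases k.eq_zero_or_pos with rfl | hk
  · simp [circleKernel]
  have hk' : (0:ℝ) < k := by exact_mod_cast hk
  set A : ℝ := 128 * ((1 / (1 - 1/4) + 1 / (1/4)) * (k : ℝ) ^ (1/4 : ℝ)) with hA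
  have hA0 : 0 ≤ A := by
    have : (0:ℝ) ≤ 1 / (1 - 1/4) + 1 / (1/4) := by norm_num
    positivity
  have h1 : ∀ ρ ∈ Ioo (0:ℝ) 1, ENNReal.ofReal ((1 - ρ) ^ (-(1/2) : ℝ)) * circleKernel k ρ ≤
      ENNReal.ofReal A * ENNReal.ofReal (min ((1 - ρ) ^ (-((3/4 : ℝ) + 1)))
        (k * (1 - ρ) ^ (-(3/4) : ℝ))) := fun ρ hρ => by
    have ht : 0 < 1 - ρ := by linarith [hρ.2]
    refine (mul_le_mul_right (circleKernel_le hk hρ.1.le hρ.2) _).trans ?_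
    rw [mul_left_comm, ← ENNReal.ofReal_mul (by positivity),
      mul_min_of_nonneg _ _ (by positivity), mul_left_comm _ (k : ℝ), ← Real.rpow_add ht,
      ← Real.rpow_add ht, hA, show (-(1/2) : ℝ) + -(5/4) = -((3/4 : ℝ) + 1) by norm_num,
      show (-(1/2) : ℝ) + -(1/4) = -(3/4) by norm_num]
  refine (setLIntegral_mono' measurableSet_Ioo h1).trans ?_
  rw [lintegral_const_mul' _ _ ENNReal.ofReal_ne_top]
  have h2 := lintegral_Ioo_one_sub_le fun t => ENNReal.ofReal (min (t ^ (-((3/4 : ℝ) + 1)))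
        (k * t ^ (-(3/4) : ℝ)))
  have h3 := lintegral_min_rpow_le (s := 3/4) (by norm_num) (by norm_num) hk'
  refine (mul_le_mul_right (h2.trans h3) _).trans ?_
  rw [← ENNReal.ofReal_mul hA0]
  refine ENNReal.ofReal_le_ofReal (le_of_eq ?_)
  have : (k : ℝ) ^ (1/4 : ℝ) * (k : ℝ) ^ (3/4 : ℝ) = k := by
    rw [← Real.rpow_add hk']
    norm_num
  rw [hA]
  linear_combination (128 * (1 / (1 - 1/4) + 1 / (1/4)) * (1 / (1 - 3/4) + 1 / (3/4))) * this

end KernelEstimate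

end BoundaryFlat

namespace BoundaryFlat

open scoped Real Topology

section SquareIntegrability

variable {F : ℂ → ℂ}

/-- The weighted squared difference quotient of `F`. -/
noncomputable def diffKernel (F : ℂ → ℂ) (ζ z : ℂ) : ℝ≥0∞ :=
  ENNReal.ofReal (‖F ζ - F z‖ ^ 2 * ‖ζ - z‖ ^ (-(5/2) : ℝ))

theorem measurable_diffKernel {X : Type*} [MeasurableSpace X] (hFc : Continuous F) {u v : X → ℂ}
    (hu : Measurable u) (hv : Measurable v) : Measurable fun x => diffKernel F (u x) (v x) := by
  unfold diffKernel
  have h1 : Measurable fun x => ‖F (u x) - F (v x)‖ ^ 2 :=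
    ((hFc.measurable.comp hu).sub (hFc.measurable.comp hv)).norm.pow_const 2
  have h2 : Measurable fun x => ‖u x - v x‖ ^ (-(5/2) : ℝ) := (hu.sub hv).norm.pow_const _
  exact (h1.mul h2).ennreal_ofReal

theorem exists_sq_osc_div_le : ∃ C : ℝ, 0 < C ∧ ∀ F : ℂ → ℂ, Continuous F → ∀ z : ℂ, ‖z‖ < 1 →
    ENNReal.ofReal ((osc F z / (1 - ‖z‖ ^ 2)) ^ 2) ≤
      ENNReal.ofReal (C * (1 - ‖z‖) ^ (-(1/2) : ℝ)) *
        ∫⁻ θ, diffKernel F (circleMap 0 1 θ) z ∂circProb := by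
  obtain ⟨C, hC, h⟩ := exists_lintegral_norm_sub_rpow_le
  refine ⟨C, hC, fun F hFc z hz => ?_⟩
  have hcirc := continuous_circleMap 0 1
  have hcA : Continuous fun θ =>
      ‖F (circleMap 0 1 θ) - F z‖ * ‖circleMap 0 1 θ - z‖ ^ (-(5/4) : ℝ) :=
    (by fun_prop : Continuous fun θ => ‖F (circleMap 0 1 θ) - F z‖).mul
      (continuous_norm_sub_rpow hz _)
  have hcB : Continuous fun θ => ‖circleMap 0 1 θ - z‖ ^ (-(3/4) : ℝ) :=
    continuous_norm_sub_rpow hz _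
  have e : ∀ θ, ‖F (circleMap 0 1 θ) - F z‖ / ‖circleMap 0 1 θ - z‖ ^ 2 =
      ‖F (circleMap 0 1 θ) - F z‖ * ‖circleMap 0 1 θ - z‖ ^ (-(5/4) : ℝ) *
        ‖circleMap 0 1 θ - z‖ ^ (-(3/4) : ℝ) := fun θ => by
    have hx := circleMap_sub_pos hz θ
    rw [mul_assoc, ← Real.rpow_add hx, show (-(5/4) : ℝ) + -(3/4) = -((2 : ℕ) : ℝ) by norm_num,
      Real.rpow_neg hx.le, Real.rpow_natCast, div_eq_mul_inv]
  have h1 : ENNReal.ofReal (osc F z / (1 - ‖z‖ ^ 2)) =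
      ∫⁻ θ, ENNReal.ofReal (‖F (circleMap 0 1 θ) - F z‖ * ‖circleMap 0 1 θ - z‖ ^ (-(5/4) : ℝ)) *
        ENNReal.ofReal (‖circleMap 0 1 θ - z‖ ^ (-(3/4) : ℝ)) ∂circProb := by
    rw [osc_div_eq hz]
    simp only [e]
    have hi : Integrable (fun θ => ‖F (circleMap 0 1 θ) - F z‖ *
        ‖circleMap 0 1 θ - z‖ ^ (-(5/4) : ℝ) * ‖circleMap 0 1 θ - z‖ ^ (-(3/4) : ℝ)) circProb :=
      integrable_circProb_of_continuous (hcA.mul hcB)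
    rw [ofReal_integral_eq_lintegral_ofReal hi (ae_of_all _ fun θ => by positivity)]
    refine lintegral_congr fun θ => ?_
    rw [ENNReal.ofReal_mul (by positivity)]
  have h2 := ENNReal.lintegral_mul_le_Lp_mul_Lq circProb Real.HolderConjugate.two_two
    hcA.measurable.ennreal_ofReal.aemeasurable hcB.measurable.ennreal_ofReal.aemeasurable
  simp only [Pi.mul_apply] at h2
  rw [← h1] at h2
  have eA : ∀ θ, ENNReal.ofReal
      (‖F (circleMap 0 1 θ) - F z‖ * ‖circleMap 0 1 θ - z‖ ^ (-(5/4) : ℝ)) ^ (2:ℝ) =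
      diffKernel F (circleMap 0 1 θ) z := fun θ => by
    rw [diffKernel, ENNReal.ofReal_rpow_of_nonneg (by positivity) (by norm_num),
      Real.mul_rpow (by positivity) (by positivity), ← Real.rpow_mul (norm_nonneg _)]
    norm_num
  have eB : ∀ θ, ENNReal.ofReal (‖circleMap 0 1 θ - z‖ ^ (-(3/4) : ℝ)) ^ (2:ℝ) =
      ENNReal.ofReal (‖circleMap 0 1 θ - z‖ ^ (-(3/2) : ℝ)) := fun θ => by
    rw [ENNReal.ofReal_rpow_of_nonneg (by positivity) (by norm_num),
      ← Real.rpow_mul (norm_nonneg _)]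
    norm_num
  simp only [eA, eB] at h2
  have h0 : 0 ≤ osc F z / (1 - ‖z‖ ^ 2) := div_nonneg (osc_nonneg hz) (one_sub_sq_pos hz).le
  rw [ENNReal.ofReal_pow h0]
  have hsq : ∀ a : ℝ≥0∞, (a ^ (1/2 : ℝ)) ^ 2 = a := fun a => by
    rw [← ENNReal.rpow_natCast, ← ENNReal.rpow_mul]
    norm_num
  calc _ ≤ ((∫⁻ θ, diffKernel F (circleMap 0 1 θ) z ∂circProb) ^ (1/2 : ℝ) *
        (∫⁻ θ, ENNReal.ofReal (‖circleMap 0 1 θ - z‖ ^ (-(3/2) : ℝ)) ∂circProb) ^ (1/2 : ℝ)) ^ 2 :=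
        by gcongr
    _ = (∫⁻ θ, ENNReal.ofReal (‖circleMap 0 1 θ - z‖ ^ (-(3/2) : ℝ)) ∂circProb) *
        ∫⁻ θ, diffKernel F (circleMap 0 1 θ) z ∂circProb := by
        rw [mul_pow, hsq, hsq, mul_comm]
    _ ≤ _ := by
        gcongr
        exact h z hz

theorem lintegral_diffKernel_le (hF : DifferentiableOn ℂ F (ball 0 1)) (hFc : Continuous F)
    {ρ : ℝ} (h0 : 0 ≤ ρ) (h1 : ρ < 1) :
    ∫⁻ φ, ∫⁻ θ, diffKernel F (circleMap 0 1 θ) (ρ * circleMap 0 1 φ) ∂circProb ∂circProb ≤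
      ∑' k : ℕ, ENNReal.ofReal (‖taylorCoeff F k‖ ^ 2) * circleKernel k ρ := by
  have hcirc := continuous_circleMap 0 1
  have c1 : Measurable fun p : ℝ × ℝ => circleMap 0 1 p.1 :=
    hcirc.measurable.comp measurable_fst
  have c2 : Measurable fun p : ℝ × ℝ => circleMap 0 1 p.2 :=
    hcirc.measurable.comp measurable_snd
  have m1 : Measurable fun p : ℝ × ℝ =>
      diffKernel F (circleMap 0 1 p.2) (ρ * circleMap 0 1 p.1) :=
    measurable_diffKernel hFc c2 (c1.const_mul _)
  have m2 : Measurable fun p : ℝ × ℝ =>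
      diffKernel F (circleMap 0 1 p.1) (ρ * (circleMap 0 1 p.2 * circleMap 0 1 p.1)) :=
    measurable_diffKernel hFc c1 ((c2.mul c1).const_mul _)
  rw [lintegral_lintegral_swap m1.aemeasurable]
  have e1 : ∀ θ, ∫⁻ φ, diffKernel F (circleMap 0 1 θ) (ρ * circleMap 0 1 φ) ∂circProb =
      ∫⁻ φ, diffKernel F (circleMap 0 1 θ) (ρ * (circleMap 0 1 φ * circleMap 0 1 θ)) ∂circProb :=
    fun θ => (lintegral_circProb_rotate
      (fun ζ => diffKernel F (circleMap 0 1 θ) (ρ * ζ)) θ).symm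
  simp only [e1]
  rw [lintegral_lintegral_swap m2.aemeasurable]
  have e2 : ∀ φ, ∫⁻ θ, diffKernel F (circleMap 0 1 θ)
      (ρ * (circleMap 0 1 φ * circleMap 0 1 θ)) ∂circProb ≤
      ∑' k : ℕ, ENNReal.ofReal (‖taylorCoeff F k‖ ^ 2) *
        ENNReal.ofReal (‖1 - ρ * circleMap 0 1 φ‖ ^ (-(5/2) : ℝ) *
          ‖1 - (ρ * circleMap 0 1 φ) ^ k‖ ^ 2) := fun φ => by
    set w : ℂ := ρ * circleMap 0 1 φ with hw
    have hwn : ‖w‖ < 1 := by simp [hw, abs_of_nonneg h0, h1]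
    have e3 : ∀ θ, diffKernel F (circleMap 0 1 θ) (ρ * (circleMap 0 1 φ * circleMap 0 1 θ)) =
        ENNReal.ofReal (‖1 - w‖ ^ (-(5/2) : ℝ)) *
          ENNReal.ofReal (‖F (circleMap 0 1 θ) - F (circleMap 0 1 θ * w)‖ ^ 2) := fun θ => by
      have a1 : (ρ : ℂ) * (circleMap 0 1 φ * circleMap 0 1 θ) = circleMap 0 1 θ * w := by
        rw [hw]; ring
      have a2 : ‖circleMap 0 1 θ - circleMap 0 1 θ * w‖ = ‖1 - w‖ := by
        rw [← mul_one_sub, norm_mul, norm_circleMap_one, one_mul]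
      rw [diffKernel, a1, a2, mul_comm, ENNReal.ofReal_mul (by positivity)]
    simp only [e3]
    rw [lintegral_const_mul' _ _ ENNReal.ofReal_ne_top]
    refine (mul_le_mul_right (lintegral_sq_norm_sub_circle_le hF hFc hwn) _).trans (le_of_eq ?_)
    rw [← ENNReal.tsum_mul_left]
    congr 1 with k
    rw [← ENNReal.ofReal_mul (by positivity), ← ENNReal.ofReal_mul (by positivity)]
    congr 1
    ring
  refine (lintegral_mono e2).trans (le_of_eq ?_)
  have m3 : ∀ k : ℕ, Measurable fun φ => ENNReal.ofReal (‖taylorCoeff F k‖ ^ 2) *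
        ENNReal.ofReal (‖1 - ρ * circleMap 0 1 φ‖ ^ (-(5/2) : ℝ) *
          ‖1 - (ρ * circleMap 0 1 φ) ^ k‖ ^ 2) := fun k => by
    have c1 : Continuous fun φ => ‖1 - ρ * circleMap 0 1 φ‖ := by fun_prop
    have c2 : Continuous fun φ => ‖1 - (ρ * circleMap 0 1 φ) ^ k‖ ^ 2 := by fun_prop
    exact ((c1.measurable.pow_const _).mul c2.measurable).ennreal_ofReal.const_mul _
  rw [lintegral_tsum fun k => (m3 k).aemeasurable]
  simp only [lintegral_const_mul' _ _ ENNReal.ofReal_ne_top, circleKernel]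

theorem measurable_circleKernel (k : ℕ) : Measurable (circleKernel k) := by
  have hcirc := continuous_circleMap 0 1
  have c1 : Continuous fun p : ℝ × ℝ => ‖1 - p.1 * circleMap 0 1 p.2‖ := by fun_prop
  have c2 : Continuous fun p : ℝ × ℝ => ‖1 - (p.1 * circleMap 0 1 p.2) ^ k‖ ^ 2 := by fun_prop
  exact Measurable.lintegral_prod_right'
    ((c1.measurable.pow_const (-(5/2) : ℝ)).mul c2.measurable).ennreal_ofReal

theorem lintegral_sq_osc_div_lt_top (hF : DifferentiableOn ℂ F (ball 0 1)) (hFc : Continuous F)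
    (h : ∫⁻ z in ball 0 1, ENNReal.ofReal (‖deriv F z‖ ^ 2) < ⊤) :
    ∫⁻ z in ball 0 1, ENNReal.ofReal ((osc F z / (1 - ‖z‖ ^ 2)) ^ 2) < ⊤ := by
  obtain ⟨C, hC, h1⟩ := exists_sq_osc_div_le
  obtain ⟨C', hC', h2⟩ := exists_lintegral_circleKernel_le
  have hcirc := continuous_circleMap 0 1
  have m1 : Measurable fun z : ℂ => ENNReal.ofReal (C * (1 - ‖z‖) ^ (-(1/2) : ℝ)) *
      ∫⁻ θ, diffKernel F (circleMap 0 1 θ) z ∂circProb := by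
    refine Measurable.mul ?_ ?_
    · exact (((measurable_const.sub measurable_norm).pow_const _).const_mul _).ennreal_ofReal
    · exact Measurable.lintegral_prod_right' (f := fun p : ℂ × ℝ =>
        diffKernel F (circleMap 0 1 p.2) p.1)
        (measurable_diffKernel hFc (hcirc.measurable.comp measurable_snd) measurable_fst)
  have m2 : ∀ k : ℕ, Measurable fun ρ : ℝ => ENNReal.ofReal (2 * π * C) *
      (ENNReal.ofReal (‖taylorCoeff F k‖ ^ 2) *
        (ENNReal.ofReal ((1 - ρ) ^ (-(1/2) : ℝ)) * circleKernel k ρ)) := fun k =>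
    ((((measurable_const.sub measurable_id).pow_const _).ennreal_ofReal.mul
      (measurable_circleKernel k)).const_mul _).const_mul _
  calc _ ≤ ∫⁻ z in ball 0 1, ENNReal.ofReal (C * (1 - ‖z‖) ^ (-(1/2) : ℝ)) *
        ∫⁻ θ, diffKernel F (circleMap 0 1 θ) z ∂circProb :=
        setLIntegral_mono' measurableSet_ball fun z hz => h1 F hFc z (by simpa using hz)
    _ ≤ ∫⁻ ρ in Ioo (0:ℝ) 1, ∑' k : ℕ, ENNReal.ofReal (2 * π * C) *
      (ENNReal.ofReal (‖taylorCoeff F k‖ ^ 2) *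
        (ENNReal.ofReal ((1 - ρ) ^ (-(1/2) : ℝ)) * circleKernel k ρ)) := by
        rw [lintegral_ball_eq m1]
        refine setLIntegral_mono' measurableSet_Ioo fun ρ hρ => ?_
        have hn : ∀ φ, ‖(ρ : ℂ) * circleMap 0 1 φ‖ = ρ := fun φ => by
          simp [abs_of_pos hρ.1]
        have ht : 0 < 1 - ρ := by linarith [hρ.2]
        simp only [hn]
        rw [lintegral_const_mul' _ _ ENNReal.ofReal_ne_top, ENNReal.tsum_mul_left, ← mul_assoc,
          ← ENNReal.ofReal_mul (by have := hρ.1; positivity)]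
        have e : ∑' k : ℕ, ENNReal.ofReal (‖taylorCoeff F k‖ ^ 2) *
            (ENNReal.ofReal ((1 - ρ) ^ (-(1/2) : ℝ)) * circleKernel k ρ) =
            ENNReal.ofReal ((1 - ρ) ^ (-(1/2) : ℝ)) *
              ∑' k : ℕ, ENNReal.ofReal (‖taylorCoeff F k‖ ^ 2) * circleKernel k ρ := by
          rw [← ENNReal.tsum_mul_left]
          simp only [mul_left_comm]
        rw [e, ← mul_assoc (ENNReal.ofReal (2 * π * C)), ← ENNReal.ofReal_mul (by positivity)]
        refine mul_le_mul' (ENNReal.ofReal_le_ofReal ?_)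
          (lintegral_diffKernel_le hF hFc hρ.1.le hρ.2)
        have : 0 ≤ 2 * π * C * (1 - ρ) ^ (-(1/2) : ℝ) := by positivity
        nlinarith [hρ.2]
    _ = ∑' k : ℕ, ENNReal.ofReal (2 * π * C) * (ENNReal.ofReal (‖taylorCoeff F k‖ ^ 2) *
        ∫⁻ ρ in Ioo (0:ℝ) 1, ENNReal.ofReal ((1 - ρ) ^ (-(1/2) : ℝ)) * circleKernel k ρ) := by
        rw [lintegral_tsum fun k => (m2 k).aemeasurable]
        simp only [lintegral_const_mul' _ _ ENNReal.ofReal_ne_top]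
    _ ≤ ∑' k : ℕ, ENNReal.ofReal (2 * π * C) * (ENNReal.ofReal C' *
        ENNReal.ofReal ((k : ℝ) * ‖taylorCoeff F k‖ ^ 2)) := by
        refine ENNReal.tsum_le_tsum fun k => ?_
        refine mul_le_mul_right ((mul_le_mul_right (h2 k) _).trans (le_of_eq ?_)) _
        rw [← ENNReal.ofReal_mul (by positivity), ← ENNReal.ofReal_mul (by positivity)]
        congr 1
        ring
    _ < ⊤ := by
        rw [ENNReal.tsum_mul_left, ENNReal.tsum_mul_left]
        exact ENNReal.mul_lt_top ENNReal.ofReal_lt_top (ENNReal.mul_lt_top ENNReal.ofReal_lt_top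
          (tsum_mul_sq_norm_taylorCoeff_lt_top hF h))

theorem exists_continuous_eqOn {f : ℂ → ℂ} (hf : ContinuousOn f (closedBall 0 1)) :
    ∃ F : ℂ → ℂ, Continuous F ∧ EqOn F f (closedBall 0 1) := by
  have hne : ∀ z : ℂ, max 1 ‖z‖ ≠ 0 := fun z => (zero_lt_one.trans_le (le_max_left _ _)).ne'
  refine ⟨fun z => f ((max 1 ‖z‖)⁻¹ • z), hf.comp_continuous ?_ fun z => ?_, fun z hz => ?_⟩
  · exact ((continuous_const.max continuous_norm).inv₀ hne).smul continuous_id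
  · rw [mem_closedBall_zero_iff, norm_smul, norm_inv, Real.norm_of_nonneg (by positivity),
      inv_mul_le_one₀ (by positivity)]
    exact le_max_right _ _
  · rw [mem_closedBall_zero_iff] at hz
    simp [max_eq_left hz]

theorem lintegral_sq_osc_div_lt_top_of_isDiscReg {f : ℂ → ℂ} (hf : IsDiscReg f)
    (h : ∫⁻ z in ball 0 1, ENNReal.ofReal (‖deriv f z‖ ^ 2) < ⊤) :
    ∫⁻ z in ball 0 1, ENNReal.ofReal ((osc f z / (1 - ‖z‖ ^ 2)) ^ 2) < ⊤ := by
  obtain ⟨F, hFc, hFf⟩ := exists_continuous_eqOn hf.2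
  have hb : EqOn F f (ball 0 1) := hFf.mono ball_subset_closedBall
  have hd : ∀ z ∈ ball (0:ℂ) 1, deriv F z = deriv f z := fun z hz =>
    (hb.eventuallyEq_of_mem (isOpen_ball.mem_nhds hz)).deriv_eq
  have ho : ∀ z ∈ ball (0:ℂ) 1, osc F z = osc f z := fun z hz => by
    simp only [osc, hFf (circleMap_mem_closedBall _), hb hz]
  have h1 := lintegral_sq_osc_div_lt_top (hf.1.congr hb) hFc (by
    rwa [setLIntegral_congr_fun measurableSet_ball fun z hz => by rw [hd z hz]])
  rwa [setLIntegral_congr_fun measurableSet_ball fun z hz => by rw [ho z hz]] at h1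

end SquareIntegrability

end BoundaryFlat

namespace BoundaryFlat

open scoped Real Topology

section Convergence

variable {α N c r ε : ℝ} {f : ℂ → ℂ} {z z₀ : ℂ} {g : ℕ → ℂ → ℂ}

theorem eventually_flatOuter_close (hf : IsDiscReg f) (hN : 0 ≤ N) (hz₀ : ‖z₀‖ < 1)
    (hfz₀ : f z₀ ≠ 0) (hr : r < 1) (hε : 0 < ε) :
    ∀ᶠ n : ℕ in atTop, ∀ z : ℂ, ‖z‖ ≤ r → ‖flatOuter f N (n + 1) z - 1‖ ≤ ε ∧
      ‖deriv (flatOuter f N (n + 1)) z‖ ≤ ε := by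
  have hI := tendsto_integral_cutLog (diffContOnCl_of_isDiscReg hf) (continuous_boundary hf.2)
    (exists_boundary_bound hf.2) hN hz₀ hfz₀
  have ht : 0 < 1 - r := by linarith
  have t1 := hI.const_mul (2 / (1 - r))
  have t2 := t1.const_mul (2 / (1 - r))
  simp only [mul_zero] at t1 t2
  have e1 : ∀ᶠ n : ℕ in atTop, 2 / (1 - r) *
      ∫ θ, |cutLog f N (n + 1) (circleMap 0 1 θ)| ∂circProb < min 1 (ε / 2) :=
    t1.eventually_lt_const (by positivity)
  have e2 : ∀ᶠ n : ℕ in atTop, 2 / (1 - r) * (2 / (1 - r) *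
      ∫ θ, |cutLog f N (n + 1) (circleMap 0 1 θ)| ∂circProb) < ε :=
    t2.eventually_lt_const hε
  filter_upwards [e1, e2] with n h1 h2 z hz
  have hz1 : ‖z‖ < 1 := hz.trans_lt hr
  have hc1 : (1:ℝ) ≤ n + 1 := by linarith [Nat.cast_nonneg (α := ℝ) n]
  have hV := integrable_cutLog' hf hN hc1 hz₀ hfz₀
  have hI0 : 0 ≤ ∫ θ, |cutLog f N (n + 1) (circleMap 0 1 θ)| ∂circProb :=
    integral_nonneg fun _ => abs_nonneg _
  have hq : 2 / (1 - ‖z‖) ≤ 2 / (1 - r) := by gcongr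
  have hq' : 2 / (1 - ‖z‖ ^ 2) ≤ 2 / (1 - r) := by
    gcongr
    nlinarith [norm_nonneg z]
  have a1 : ‖herglotz (cutLog f N (n + 1)) z‖ ≤ 2 / (1 - r) *
      ∫ θ, |cutLog f N (n + 1) (circleMap 0 1 θ)| ∂circProb :=
    (norm_herglotz_le hV hz1).trans (by gcongr)
  have a2 : ‖deriv (herglotz (cutLog f N (n + 1))) z‖ ≤ 2 / (1 - r) * (2 / (1 - r) *
      ∫ θ, |cutLog f N (n + 1) (circleMap 0 1 θ)| ∂circProb) := by
    refine (norm_deriv_herglotz_le_one_sub hV hz1).trans ?_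
    have : 0 < 1 - ‖z‖ := by linarith
    gcongr
  constructor
  · have := Complex.norm_exp_sub_one_le (a1.trans (h1.le.trans (min_le_left _ _)))
    have h3 := a1.trans (h1.le.trans (min_le_right _ _))
    unfold flatOuter
    linarith
  · rw [(hasDerivAt_flatOuter hf hN hc1 hz₀ hfz₀ hz1).deriv, norm_mul]
    exact (mul_le_of_le_one_left (norm_nonneg _)
      (norm_flatOuter_le_one hf hN hc1 hz₀ hfz₀ hz1)).trans (a2.trans h2.le)

theorem hasDerivAt_mul_sub (hf : IsDiscReg f) (hN : 0 ≤ N) (hc1 : 1 ≤ c) (hz₀ : ‖z₀‖ < 1)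
    (hfz₀ : f z₀ ≠ 0) {g : ℂ → ℂ} (hg : EqOn g (flatOuter f N c) (ball 0 1)) (hz : ‖z‖ < 1) :
    HasDerivAt (f * g - f)
      (deriv f z * (flatOuter f N c z - 1) + f z * deriv (flatOuter f N c) z) z := by
  have hzb : z ∈ ball (0:ℂ) 1 := by simpa using hz
  have h1 : HasDerivAt f (deriv f z) z :=
    (hf.1.differentiableAt (isOpen_ball.mem_nhds hzb)).hasDerivAt
  have h2 := (hasDerivAt_mul_flatOuter hf hN hc1 hz₀ hfz₀ hz).sub h1
  have h3 : f * g - f =ᶠ[𝓝 z] (fun z => f z * flatOuter f N c z) - f := by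
    filter_upwards [isOpen_ball.mem_nhds hzb] with w hw
    simp [hg hw]
  exact (h2.congr_of_eventuallyEq h3).congr_deriv (by ring)

theorem deriv_mul_eq {g : ℂ → ℂ} (hg : EqOn g (flatOuter f N c) (ball 0 1)) (hz : ‖z‖ < 1) :
    deriv (f * g) z = deriv (fun z => f z * flatOuter f N c z) z := by
  have hzb : z ∈ ball (0:ℂ) 1 := by simpa using hz
  refine Filter.EventuallyEq.deriv_eq ?_
  filter_upwards [isOpen_ball.mem_nhds hzb] with w hw
  simp [hg hw]

theorem norm_deriv_mul_sub_le (hf : IsDiscReg f) (hN : 0 ≤ N) (hc1 : 1 ≤ c) (hz₀ : ‖z₀‖ < 1)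
    (hfz₀ : f z₀ ≠ 0) {g : ℂ → ℂ} (hg : EqOn g (flatOuter f N c) (ball 0 1)) (hz : ‖z‖ < 1) :
    ‖deriv (f * g - f) z‖ ≤ 2 * ‖deriv f z‖ + 4 * N * (osc f z / (1 - ‖z‖ ^ 2)) := by
  rw [(hasDerivAt_mul_sub hf hN hc1 hz₀ hfz₀ hg hz).deriv]
  refine (norm_add_le _ _).trans (add_le_add ?_
    (norm_mul_deriv_flatOuter_le hf hN hc1 hz₀ hfz₀ hz))
  rw [norm_mul, mul_comm]
  gcongr
  refine (norm_sub_le _ _).trans ?_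
  have := norm_flatOuter_le_one hf hN hc1 hz₀ hfz₀ hz
  rw [norm_one]
  linarith

theorem eventually_norm_deriv_mul_sub_le (hα0 : 0 < α) (hf : IsDiscReg f) (hL : LittleLip α f)
    (hα1 : α ≤ 1/2)
    (hN : 0 ≤ N) (hz₀ : ‖z₀‖ < 1) (hfz₀ : f z₀ ≠ 0)
    (hg : ∀ n : ℕ, EqOn (g n) (flatOuter f N (n + 1)) (ball 0 1)) (hr : r < 1) (hε : 0 < ε) :
    ∀ᶠ n : ℕ in atTop, ∀ z : ℂ, ‖z‖ ≤ r → ‖deriv (f * g n - f) z‖ ≤ ε := by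
  obtain ⟨K, hK, hd⟩ := smallGrowth_deriv hα0 hf.1 hf.2 hL 1 one_pos
  obtain ⟨S, hS, hfS⟩ := exists_norm_bound hf.2
  have ht : 0 < 1 - r := by linarith
  set B : ℝ := (1 - r) ^ (α - 1) + K + S + 1 with hB
  have hB0 : 0 < B := by positivity
  filter_upwards [eventually_flatOuter_close hf hN hz₀ hfz₀ hr (div_pos hε hB0)] with n hn z hz
  have hz1 : ‖z‖ < 1 := hz.trans_lt hr
  have hc1 : (1:ℝ) ≤ n + 1 := by linarith [Nat.cast_nonneg (α := ℝ) n]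
  rw [(hasDerivAt_mul_sub hf hN hc1 hz₀ hfz₀ (hg n) hz1).deriv]
  have h1 : ‖deriv f z‖ ≤ (1 - r) ^ (α - 1) + K := by
    refine (hd z hz1).trans ?_
    rw [one_mul]
    have := Real.rpow_le_rpow_of_nonpos ht (by linarith : 1 - r ≤ 1 - ‖z‖)
      (by linarith : α - 1 ≤ 0)
    linarith
  have h2 := hfS z (by simpa using hz1.le)
  obtain ⟨h3, h4⟩ := hn z hz
  calc _ ≤ ‖deriv f z‖ * ‖flatOuter f N (n + 1) z - 1‖ +
        ‖f z‖ * ‖deriv (flatOuter f N (n + 1)) z‖ := by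
        rw [← norm_mul, ← norm_mul]; exact norm_add_le _ _
    _ ≤ ((1 - r) ^ (α - 1) + K) * (ε / B) + S * (ε / B) := by gcongr
    _ = (B - 1) * (ε / B) := by rw [hB]; ring
    _ ≤ B * (ε / B) := by gcongr; linarith
    _ = ε := by field_simp

theorem eventually_weighted_deriv_le (hα0 : 0 < α) (hα1 : α ≤ 1/2) (hf : IsDiscReg f)
    (hL : LittleLip α f) (hN : 0 ≤ N) (hz₀ : ‖z₀‖ < 1) (hfz₀ : f z₀ ≠ 0)
    (hg : ∀ n : ℕ, EqOn (g n) (flatOuter f N (n + 1)) (ball 0 1)) (hε : 0 < ε) :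
    ∀ᶠ n : ℕ in atTop, ∀ z : ℂ, ‖z‖ < 1 →
      (1 - ‖z‖) ^ (1 - α) * ‖deriv (f * g n - f) z‖ ≤ ε := by
  obtain ⟨K, hK, hb⟩ := (((smallGrowth_deriv hα0 hf.1 hf.2 hL).const_mul zero_le_two).add
    ((smallGrowth_osc hα1 hf.2 (continuous_boundary hf.2) hL).const_mul
      (c := 4 * N) (by positivity))) (ε / 2) (half_pos hε)
  have hlim : Tendsto (fun t : ℝ => K * t ^ (1 - α)) (𝓝[>] 0) (𝓝 0) := by
    have hc : Continuous fun t : ℝ => K * t ^ (1 - α) :=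
      continuous_const.mul (continuous_id.rpow_const fun _ => Or.inr (by linarith))
    have := hc.tendsto 0
    rw [Real.zero_rpow (by linarith), mul_zero] at this
    exact this.mono_left nhdsWithin_le_nhds
  obtain ⟨t, ht, ht0⟩ :=
    ((hlim.eventually_lt_const (half_pos hε)).and self_mem_nhdsWithin).exists
  have ht0' : 0 < t := ht0
  filter_upwards [eventually_norm_deriv_mul_sub_le hα0 hf hL hα1 hN hz₀ hfz₀ hg
    (by linarith : 1 - t < 1) hε] with n hn z hz
  have hs : 0 < 1 - ‖z‖ := by linarith
  rcases le_total ‖z‖ (1 - t) with h | h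
  · have h1 : (1 - ‖z‖) ^ (1 - α) ≤ 1 :=
      Real.rpow_le_one hs.le (by linarith [norm_nonneg z]) (by linarith)
    exact (mul_le_of_le_one_left (norm_nonneg _) h1).trans (hn z h)
  · have hc1 : (1:ℝ) ≤ n + 1 := by linarith [Nat.cast_nonneg (α := ℝ) n]
    have h1 := (norm_deriv_mul_sub_le hf hN hc1 hz₀ hfz₀ (hg n) hz).trans (hb z hz)
    have h2 : (1 - ‖z‖) ^ (1 - α) ≤ t ^ (1 - α) :=
      Real.rpow_le_rpow hs.le (by linarith) (by linarith)
    have h3 : (1 - ‖z‖) ^ (1 - α) * (1 - ‖z‖) ^ (α - 1) = 1 := by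
      rw [← Real.rpow_add hs]; simp
    calc _ ≤ (1 - ‖z‖) ^ (1 - α) * (ε / 2 * (1 - ‖z‖) ^ (α - 1) + K) := by gcongr
      _ = ε / 2 * ((1 - ‖z‖) ^ (1 - α) * (1 - ‖z‖) ^ (α - 1)) + K * (1 - ‖z‖) ^ (1 - α) := by ring
      _ ≤ ε / 2 * 1 + K * t ^ (1 - α) := by rw [h3]; gcongr
      _ ≤ ε := by linarith

end Convergence

section Norms

variable {α A B : ℝ} {F : ℂ → ℂ}

theorem lipNorm_nonneg (α : ℝ) (F : ℂ → ℂ) : 0 ≤ lipNorm α F := by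
  refine add_nonneg (Real.sSup_nonneg ?_) (Real.sSup_nonneg ?_)
  · rintro _ ⟨z, -, rfl⟩
    exact norm_nonneg _
  · rintro _ ⟨z, hz, rfl⟩
    have : ‖z‖ < 1 := by simpa [uDisc] using hz
    exact mul_nonneg (Real.rpow_nonneg (by linarith) _) (norm_nonneg _)

theorem lipNorm_le (hα0 : 0 < α) (hα1 : α < 1) (hF : DifferentiableOn ℂ F (ball 0 1))
    (hA : 0 ≤ A) (h : ∀ z : ℂ, ‖z‖ < 1 → (1 - ‖z‖) ^ (1 - α) * ‖deriv F z‖ ≤ A) :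
    lipNorm α F ≤ ‖F 0‖ + A / α + A := by
  have hb : ∀ z : ℂ, ‖z‖ < 1 → ‖deriv F z‖ ≤ A * (1 - ‖z‖) ^ (α - 1) + 0 := fun z hz => by
    have hs : 0 < 1 - ‖z‖ := by linarith
    have h3 : (1 - ‖z‖) ^ (α - 1) * (1 - ‖z‖) ^ (1 - α) = 1 := by
      rw [← Real.rpow_add hs]; simp
    calc ‖deriv F z‖ = (1 - ‖z‖) ^ (α - 1) * ((1 - ‖z‖) ^ (1 - α) * ‖deriv F z‖) := by
          rw [← mul_assoc, h3, one_mul]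
      _ ≤ (1 - ‖z‖) ^ (α - 1) * A := by gcongr; exact h z hz
      _ = _ := by ring
  refine add_le_add (Real.sSup_le ?_ (by positivity)) (Real.sSup_le ?_ hA)
  · rintro _ ⟨z, hz, rfl⟩
    have h1 := norm_sub_smul_le hα0 hα1 hF hA hb (by simpa [uDisc] using hz) zero_le_one le_rfl
    simp only [sub_self, ofReal_zero, zero_mul, Real.one_rpow, mul_one, add_zero] at h1
    have h2 := norm_add_le (F z - F 0) (F 0)
    rw [sub_add_cancel] at h2
    show ‖F z‖ ≤ _
    linarith
  · rintro _ ⟨z, hz, rfl⟩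
    exact h z (by simpa [uDisc] using hz)

theorem dirInt_eq_toReal (F : ℂ → ℂ) :
    dirInt F = 1 / π * (∫⁻ z in ball 0 1, ENNReal.ofReal (‖deriv F z‖ ^ 2)).toReal := by
  rw [dirInt, uDisc, integral_eq_lintegral_of_nonneg_ae (ae_of_all _ fun _ => by positivity)
    ((measurable_deriv F).norm.pow_const 2).aestronglyMeasurable]

theorem memDir_iff : MemDir F ↔ DifferentiableOn ℂ F (ball 0 1) ∧
    ∫⁻ z in ball 0 1, ENNReal.ofReal (‖deriv F z‖ ^ 2) < ⊤ := by
  have h : IntegrableOn (fun z => ‖deriv F z‖ ^ 2) (ball 0 1) ↔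
      ∫⁻ z in ball 0 1, ENNReal.ofReal (‖deriv F z‖ ^ 2) < ⊤ := by
    rw [IntegrableOn, Integrable, and_iff_right
      ((measurable_deriv F).norm.pow_const 2).aestronglyMeasurable,
      hasFiniteIntegral_iff_ofReal (ae_of_all _ fun _ => by positivity)]
  rw [MemDir, uDisc, h]

end Norms

end BoundaryFlat

namespace BoundaryFlat

open scoped Real Topology

section Assembly

variable {α N c : ℝ} {f : ℂ → ℂ} {z₀ : ℂ} {g : ℕ → ℂ → ℂ}

theorem lintegral_sq_add_lt_top (hf : IsDiscReg f) (hD : MemDir f) (a b : ℝ) :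
    ∫⁻ z in ball 0 1, ENNReal.ofReal ((a * ‖deriv f z‖ + b * (osc f z / (1 - ‖z‖ ^ 2))) ^ 2)
      < ⊤ := by
  have h1 := (memDir_iff.1 hD).2
  have h2 := lintegral_sq_osc_div_lt_top_of_isDiscReg hf h1
  have hm : Measurable fun z => ENNReal.ofReal (‖deriv f z‖ ^ 2) :=
    ((measurable_deriv f).norm.pow_const 2).ennreal_ofReal
  calc _ ≤ ∫⁻ z in ball 0 1, ENNReal.ofReal (2 * a ^ 2) * ENNReal.ofReal (‖deriv f z‖ ^ 2) +
        ENNReal.ofReal (2 * b ^ 2) * ENNReal.ofReal ((osc f z / (1 - ‖z‖ ^ 2)) ^ 2) := by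
        refine lintegral_mono fun z => ?_
        rw [← ENNReal.ofReal_mul (by positivity), ← ENNReal.ofReal_mul (by positivity),
          ← ENNReal.ofReal_add (by positivity) (by positivity)]
        refine ENNReal.ofReal_le_ofReal ?_
        nlinarith [sq_nonneg (a * ‖deriv f z‖ - b * (osc f z / (1 - ‖z‖ ^ 2)))]
    _ < ⊤ := by
        rw [lintegral_add_left (hm.const_mul _), lintegral_const_mul' _ _ ENNReal.ofReal_ne_top,
          lintegral_const_mul' _ _ ENNReal.ofReal_ne_top]
        exact ENNReal.add_lt_top.2 ⟨ENNReal.mul_lt_top ENNReal.ofReal_lt_top h1,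
          ENNReal.mul_lt_top ENNReal.ofReal_lt_top h2⟩

theorem memA_mul (hα0 : 0 < α) (hα1 : α ≤ 1/2) (hf : MemA α f) (hN : 0 ≤ N) (hc1 : 1 ≤ c)
    (hz₀ : ‖z₀‖ < 1) (hfz₀ : f z₀ ≠ 0) {g : ℂ → ℂ} (hgr : IsDiscReg g)
    (hg : EqOn g (flatOuter f N c) (ball 0 1)) : MemA α (f * g) := by
  have hfr : IsDiscReg f := hf.2.1
  have hd : DifferentiableOn ℂ (f * g) (ball 0 1) := hfr.1.mul hgr.1
  have hc : ContinuousOn (f * g) (closedBall 0 1) := hfr.2.mul hgr.2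
  refine ⟨memDir_iff.2 ⟨hd, lt_of_le_of_lt ?_ (lintegral_sq_add_lt_top hfr hf.1 1 (4 * N))⟩,
    ⟨hd, hc⟩, SmallGrowth.littleLip hα0 hα1 hd hc
      ((smallGrowth_deriv_mul_flatOuter hfr hN hc1 hz₀ hfz₀ hα0 hα1 hf.2.2).mono
        fun z hz => (congrArg norm (deriv_mul_eq hg hz)).le)⟩
  refine setLIntegral_mono' measurableSet_ball fun z hz => ENNReal.ofReal_le_ofReal ?_
  have hz1 : ‖z‖ < 1 := by simpa using hz
  rw [deriv_mul_eq hg hz1, one_mul]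
  exact pow_le_pow_left₀ (norm_nonneg _)
    (norm_deriv_mul_flatOuter_le hfr hN hc1 hz₀ hfz₀ hz1) 2

theorem tendsto_dirInt_mul_sub (hα0 : 0 < α) (hα1 : α ≤ 1/2) (hf : MemA α f) (hN : 0 ≤ N)
    (hz₀ : ‖z₀‖ < 1) (hfz₀ : f z₀ ≠ 0)
    (hg : ∀ n : ℕ, EqOn (g n) (flatOuter f N (n + 1)) (ball 0 1)) :
    Tendsto (fun n => dirInt (f * g n - f)) atTop (𝓝 0) := by
  have hfr : IsDiscReg f := hf.2.1
  have h := tendsto_lintegral_of_dominated_convergence (μ := volume.restrict (ball (0:ℂ) 1))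
    (F := fun n z => ENNReal.ofReal (‖deriv (f * g n - f) z‖ ^ 2)) (f := fun _ => 0)
    (fun z => ENNReal.ofReal ((2 * ‖deriv f z‖ + 4 * N * (osc f z / (1 - ‖z‖ ^ 2))) ^ 2))
    (fun n => ((measurable_deriv _).norm.pow_const 2).ennreal_ofReal)
    (fun n => by
      refine (ae_restrict_iff' measurableSet_ball).2 (ae_of_all _ fun z hz =>
        ENNReal.ofReal_le_ofReal (pow_le_pow_left₀ (norm_nonneg _) ?_ 2))
      have hc1 : (1:ℝ) ≤ n + 1 := by linarith [Nat.cast_nonneg (α := ℝ) n]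
      exact norm_deriv_mul_sub_le hfr hN hc1 hz₀ hfz₀ (hg n) (by simpa using hz))
    (lintegral_sq_add_lt_top hfr hf.1 2 (4 * N)).ne
    ((ae_restrict_iff' measurableSet_ball).2 (ae_of_all _ fun z hz => by
      have hz1 : ‖z‖ < 1 := by simpa using hz
      have h1 : Tendsto (fun n => ‖deriv (f * g n - f) z‖) atTop (𝓝 0) := by
        refine tendsto_order.2 ⟨fun a ha => Eventually.of_forall fun n =>
          ha.trans_le (norm_nonneg _), fun a ha => ?_⟩
        filter_upwards [eventually_norm_deriv_mul_sub_le hα0 hfr hf.2.2 hα1 hN hz₀ hfz₀ hg hz1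
          (half_pos ha)] with n hn
        linarith [hn z le_rfl]
      simpa using ENNReal.tendsto_ofReal (h1.pow 2)))
  rw [lintegral_zero] at h
  simp only [dirInt_eq_toReal]
  simpa using ((ENNReal.tendsto_toReal ENNReal.zero_ne_top).comp h).const_mul (1 / π)

theorem tendsto_ANorm_mul_sub (hα0 : 0 < α) (hα1 : α ≤ 1/2) (hf : MemA α f) (hN : 0 ≤ N)
    (hz₀ : ‖z₀‖ < 1) (hfz₀ : f z₀ ≠ 0) (hgr : ∀ n, IsDiscReg (g n))
    (hg : ∀ n : ℕ, EqOn (g n) (flatOuter f N (n + 1)) (ball 0 1)) :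
    Tendsto (fun n => ANorm α (f * g n - f)) atTop (𝓝 0) := by
  have hfr : IsDiscReg f := hf.2.1
  have h1 : Tendsto (fun n => lipNorm α (f * g n - f)) atTop (𝓝 0) := by
    refine tendsto_order.2 ⟨fun a ha => Eventually.of_forall fun n =>
      ha.trans_le (lipNorm_nonneg _ _), fun a ha => ?_⟩
    set B : ℝ := ‖f 0‖ + 1 / α + 1 with hB
    have hB0 : 0 < B := by positivity
    have hε : 0 < a / 2 / B := by positivity
    filter_upwards [eventually_flatOuter_close hfr hN hz₀ hfz₀ one_half_lt_one hε,
      eventually_weighted_deriv_le hα0 hα1 hfr hf.2.2 hN hz₀ hfz₀ hg hε] with n hn1 hn2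
    have hd : DifferentiableOn ℂ (f * g n - f) (ball 0 1) := (hfr.1.mul (hgr n).1).sub hfr.1
    have h2 := lipNorm_le hα0 (by linarith) hd hε.le hn2
    have h3 : ‖(f * g n - f) 0‖ ≤ ‖f 0‖ * (a / 2 / B) := by
      have e : (f * g n - f) 0 = f 0 * (flatOuter f N (n + 1) 0 - 1) := by
        rw [Pi.sub_apply, Pi.mul_apply, hg n (by simp)]
        ring
      rw [e, norm_mul]
      gcongr
      exact (hn1 0 (by simp)).1
    calc _ ≤ ‖f 0‖ * (a / 2 / B) + (a / 2 / B) / α + a / 2 / B := by linarith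
      _ = B * (a / 2 / B) := by rw [hB]; ring
      _ = a / 2 := by field_simp
      _ < a := half_lt_self ha
  have h2 := (Real.continuous_sqrt.tendsto 0).comp
    (tendsto_dirInt_mul_sub hα0 hα1 hf hN hz₀ hfz₀ hg)
  rw [Real.sqrt_zero] at h2
  simpa [ANorm] using h1.add h2

theorem exists_ne_zero_of_closedBall (hf : ContinuousOn f (closedBall 0 1))
    (h : ∃ z ∈ closedBall (0:ℂ) 1, f z ≠ 0) : ∃ z : ℂ, ‖z‖ < 1 ∧ f z ≠ 0 := by
  by_contra! hz
  obtain ⟨w, hw, hfw⟩ := h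
  have hcl : closure (ball (0:ℂ) 1) = closedBall 0 1 := closure_ball 0 one_ne_zero
  have hE : EqOn f (fun _ => 0) (ball 0 1) := fun z hzb => hz z (by simpa using hzb)
  exact hfw (hE.of_subset_closure hf continuousOn_const ball_subset_closedBall hcl.ge hw)

end Assembly

end BoundaryFlat

/-- Approximation of `f ∈ 𝒜_α \ {0}` by multiples `f·gₙ` whose
factors vanish to order `M` at `E_f`. -/
theorem approx_by_boundary_flat_multiples (α : ℝ) (hα0 : 0 < α) (hα1 : α ≤ 1/2)
    (f : ℂ → ℂ) (hf : MemA α f)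
    (hfne : ∃ z ∈ Metric.closedBall (0:ℂ) 1, f z ≠ 0)
    (M : ℝ) (hM : 0 < M) :
    ∃ (g : ℕ → ℂ → ℂ) (C : ℕ → ℝ),
      (∀ n, 0 < C n) ∧
      (∀ n, IsDiscReg (g n)) ∧
      (∀ n, MemA α (f * g n)) ∧
      Tendsto (fun n => ANorm α (f * g n - f)) atTop (nhds 0) ∧
      (∀ n, ∀ ξ ∈ uCircle, ∀ e ∈ bZeros f, ‖g n ξ‖ ≤ C n * ‖ξ - e‖ ^ M) := by
  obtain ⟨z₀, hz₀, hfz₀⟩ := BoundaryFlat.exists_ne_zero_of_closedBall hf.2.1.2 hfne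
  obtain ⟨K, hK, hH⟩ := BoundaryFlat.exists_hoelder hα0 hα1 hf.2.1.2 hf.2.2
  have hN : 0 < M / α := div_pos hM hα0
  have hc : ∀ n : ℕ, (1:ℝ) ≤ n + 1 := fun n => by linarith [Nat.cast_nonneg (α := ℝ) n]
  choose g hg hgr hgb using fun n : ℕ => BoundaryFlat.exists_flatOuter_extension hf.2.1 hN.le
    (hc n) hz₀ hfz₀ hα0 hα1 hf.2.2 hN
  refine ⟨g, fun n => ((n + 1) * K) ^ (M / α), fun n => by positivity, hgr,
    fun n => BoundaryFlat.memA_mul hα0 hα1 hf hN.le (hc n) hz₀ hfz₀ (hgr n) (hg n),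
    BoundaryFlat.tendsto_ANorm_mul_sub hα0 hα1 hf hN.le hz₀ hfz₀ hgr hg, fun n ξ hξ e he => ?_⟩
  have hξ1 : ‖ξ‖ = 1 := by simpa [uCircle] using hξ
  have he1 : ‖e‖ = 1 := by simpa [uCircle] using he.1
  have h1 : ‖f ξ‖ ≤ K * ‖ξ - e‖ ^ α := by
    have := hH ξ (by simp [hξ1]) e (by simp [he1])
    rwa [he.2, sub_zero] at this
  calc ‖g n ξ‖ ≤ ((n + 1) * ‖f ξ‖) ^ (M / α) := hgb n ξ hξ1
    _ ≤ ((n + 1) * (K * ‖ξ - e‖ ^ α)) ^ (M / α) := by gcongr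
    _ = ((n + 1) * K) ^ (M / α) * ‖ξ - e‖ ^ M := by
      rw [← mul_assoc, Real.mul_rpow (by positivity) (by positivity),
        ← Real.rpow_mul (norm_nonneg _), mul_div_cancel₀ _ hα0.ne']
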